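/- arXiv:1507.02398 — 2 statements merged into one kernel-verified Lean document; each statement's English description precedes it below -/
import Mathlib

section
/- Let 1 < p < ∞. There exists a constant C, depending only on p and n, such that for every cube Q ⊂ ℝ^n and every f ∈ L^1(Q), ‖f − f_Q‖_{L^{p,∞},Q} ≤ C‖f‖_{JN_p^{dyadic},Q}. In particular, the dyadic John–Nirenberg space JN_p^{dyadic}(Q) embeds into weak L^p(Q). -/
open MeasureTheory Filter
open scoped ENNReal NNReal Topology

structure Cube (n : ℕ) where
  corner : Fin n → ℝ
  side : ℝ
  side_pos : 0 < side

namespace Cube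

variable {n : ℕ}

/-- The (half-open) cube determined by the data. -/
def set (Q : Cube n) : Set (Fin n → ℝ) :=
  {x | ∀ i, Q.corner i ≤ x i ∧ x i < Q.corner i + Q.side}

/-- The dyadic subcube of `Q` of generation `k` in position `m`. -/
noncomputable def dyadic (Q : Cube n) (k : ℕ) (m : Fin n → ℕ) : Cube n :=
  ⟨fun i => Q.corner i + Q.side / 2 ^ k * (m i : ℝ), Q.side / 2 ^ k,
    div_pos Q.side_pos (by positivity)⟩

/-- `Q` belongs to the family `𝒟(Q₀)` of dyadic subcubes of `Q₀`. -/
def IsDyadicSub (Q₀ Q : Cube n) : Prop :=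
  ∃ (k : ℕ) (m : Fin n → ℕ), (∀ i, m i < 2 ^ k) ∧ Q = Q₀.dyadic k m

/-- The average `(1/|Q|)∫_Q f dx` (of a nonnegative function), with values in `ℝ≥0∞`. -/
noncomputable def avg (Q : Cube n) (f : (Fin n → ℝ) → ℝ) : ℝ≥0∞ :=
  (∫⁻ x in Q.set, ENNReal.ofReal (f x)) / volume Q.set

/-- The (real-valued) average `f_Q = (1/|Q|)∫_Q f dx`. -/
noncomputable def ravg (Q : Cube n) (f : (Fin n → ℝ) → ℝ) : ℝ :=
  ⨍ x in Q.set, f x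

/-- The local dyadic maximal function `M_{Q₀} f`. -/
noncomputable def maximal (Q₀ : Cube n) (f : (Fin n → ℝ) → ℝ) (x : Fin n → ℝ) : ℝ≥0∞ :=
  ⨆ (k : ℕ) (m : Fin n → ℕ) (_ : (∀ i, m i < 2 ^ k) ∧ x ∈ (Q₀.dyadic k m).set),
    avg (Q₀.dyadic k m) f

/-- `G*_{Q₀}(x) = sup { g(Q) : Q ∈ 𝒟(Q₀), x ∈ Q }`. -/
noncomputable def gstar (Q₀ : Cube n) (g : Cube n → ℝ) (x : Fin n → ℝ) : ℝ≥0∞ :=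
  ⨆ (k : ℕ) (m : Fin n → ℕ) (_ : (∀ i, m i < 2 ^ k) ∧ x ∈ (Q₀.dyadic k m).set),
    ENNReal.ofReal (g (Q₀.dyadic k m))

/-- The local dyadic sharp maximal function `M^#_{Q₀} f`. -/
noncomputable def sharpMaximal (Q₀ : Cube n) (f : (Fin n → ℝ) → ℝ) (x : Fin n → ℝ) : ℝ≥0∞ :=
  ⨆ (k : ℕ) (m : Fin n → ℕ) (_ : (∀ i, m i < 2 ^ k) ∧ x ∈ (Q₀.dyadic k m).set),
    avg (Q₀.dyadic k m) (fun y => |f y - ravg (Q₀.dyadic k m) f|)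

/-- The normalized weak `L^p` (quasi-)norm on a cube, for an `ℝ≥0∞`-valued function. -/
noncomputable def wnorm (Q : Cube n) (p : ℝ) (f : (Fin n → ℝ) → ℝ≥0∞) : ℝ≥0∞ :=
  ⨆ (t : ℝ) (_ : 0 < t),
    ENNReal.ofReal t * (volume {x ∈ Q.set | ENNReal.ofReal t < f x} / volume Q.set) ^ (1 / p)

/-- The normalized `L^p` norm `((1/|Q|)∫_Q f^p dx)^{1/p}` for an `ℝ≥0∞`-valued function. -/
noncomputable def lpnorm (Q : Cube n) (p : ℝ) (f : (Fin n → ℝ) → ℝ≥0∞) : ℝ≥0∞ :=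
  ((∫⁻ x in Q.set, f x ^ p) / volume Q.set) ^ (1 / p)

/-- The dyadic John–Nirenberg functional `‖f‖_{JN_p^{dyadic},Q}`. -/
noncomputable def jnNorm (Q : Cube n) (p : ℝ) (f : (Fin n → ℝ) → ℝ) : ℝ≥0∞ :=
  ⨆ (𝒮 : Set (Cube n)) (_ : (∀ R ∈ 𝒮, Q.IsDyadicSub R) ∧ 𝒮.PairwiseDisjoint Cube.set),
    ((∑' R : 𝒮, avg (R : Cube n) (fun x => |f x - ravg (R : Cube n) f|) ^ p *
        volume (R : Cube n).set) / volume Q.set) ^ (1 / p)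

/-- `sup ((1/|Q|) Σ_i a(Q_i)^p |Q_i|)^{1/p}` over pairwise disjoint families in `𝒟(Q)`. -/
noncomputable def dpSup (Q : Cube n) (p : ℝ) (a : Cube n → ℝ) : ℝ≥0∞ :=
  ⨆ (𝒮 : Set (Cube n)) (_ : (∀ R ∈ 𝒮, Q.IsDyadicSub R) ∧ 𝒮.PairwiseDisjoint Cube.set),
    ((∑' R : 𝒮, ENNReal.ofReal (a (R : Cube n)) ^ p * volume (R : Cube n).set) /
      volume Q.set) ^ (1 / p)

/-- `‖a‖_{D_p,Q}`. -/
noncomputable def dpNorm (Q : Cube n) (p : ℝ) (a : Cube n → ℝ) : ℝ≥0∞ :=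
  dpSup Q p a / ENNReal.ofReal (a Q)

/-- `‖a‖_{D_p^{dyadic}(Q₀)}`. -/
noncomputable def dpGlobal (Q₀ : Cube n) (p : ℝ) (a : Cube n → ℝ) : ℝ≥0∞ :=
  ⨆ (Q : Cube n) (_ : Q₀.IsDyadicSub Q), dpNorm Q p a

theorem set_eq_pi (Q : Cube n) :
    Q.set = Set.pi Set.univ fun i => Set.Ico (Q.corner i) (Q.corner i + Q.side) := by
  ext x
  simp [set]

theorem measurableSet_set (Q : Cube n) : MeasurableSet Q.set := by
  rw [set_eq_pi]
  exact MeasurableSet.univ_pi fun _ => measurableSet_Ico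

theorem volume_set (Q : Cube n) : volume Q.set = ENNReal.ofReal (Q.side ^ n) := by
  rw [set_eq_pi, Real.volume_pi_Ico, ENNReal.ofReal_pow Q.side_pos.le]
  simp

theorem volume_set_ne_zero (Q : Cube n) : volume Q.set ≠ 0 := by
  rw [volume_set]
  simpa using pow_pos Q.side_pos n

theorem volume_set_ne_top (Q : Cube n) : volume Q.set ≠ ∞ := by
  simp [volume_set]

/-- The position of the generation `k` dyadic subcube of `Q` containing the point `x`. -/
noncomputable def idx (Q : Cube n) (k : ℕ) (x : Fin n → ℝ) (i : Fin n) : ℕ :=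
  ⌊(x i - Q.corner i) / (Q.side / 2 ^ k)⌋₊

/-- The generation `k` dyadic subcube of `Q` containing the point `x`. -/
noncomputable def subcube (Q : Cube n) (k : ℕ) (x : Fin n → ℝ) : Cube n :=
  Q.dyadic k (Q.idx k x)

theorem idx_succ (Q : Cube n) (k : ℕ) (x : Fin n → ℝ) (i : Fin n) :
    Q.idx k x i = Q.idx (k + 1) x i / 2 := by
  unfold idx
  rw [← Nat.floor_div_natCast]
  congr 1
  have := Q.side_pos.ne'
  push_cast
  field_simp
  ring

theorem idx_eq_of_le {Q : Cube n} {k l : ℕ} {x y : Fin n → ℝ} (hkl : k ≤ l)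
    (h : Q.idx l x = Q.idx l y) : Q.idx k x = Q.idx k y := by
  induction l, hkl using Nat.le_induction with
  | base => exact h
  | succ l _ ih =>
    apply ih
    ext i
    rw [idx_succ Q l x, idx_succ Q l y, h]

theorem idx_lt {Q : Cube n} {x : Fin n → ℝ} (hx : x ∈ Q.set) (k : ℕ) (i : Fin n) :
    Q.idx k x i < 2 ^ k := by
  have hs := Q.side_pos
  have h2 : (0 : ℝ) < 2 ^ k := by positivity
  unfold idx
  rw [Nat.floor_lt (div_nonneg (by linarith [(hx i).1]) (by positivity)),
    div_lt_iff₀ (by positivity)]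
  push_cast
  rw [mul_div_cancel₀ _ h2.ne']
  linarith [(hx i).2]

theorem mem_dyadic_iff {Q : Cube n} {x : Fin n → ℝ} (hx : x ∈ Q.set) (k : ℕ) (m : Fin n → ℕ) :
    x ∈ (Q.dyadic k m).set ↔ Q.idx k x = m := by
  have hs := Q.side_pos
  have h : 0 < Q.side / 2 ^ k := by positivity
  rw [funext_iff]
  refine forall_congr' fun i => ?_
  unfold idx
  rw [Nat.floor_eq_iff (div_nonneg (by linarith [(hx i).1]) h.le), le_div_iff₀ h,
    div_lt_iff₀ h]
  simp only [dyadic]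
  refine and_congr ?_ ?_ <;> constructor <;> intro h <;> nlinarith

theorem dyadic_subset (Q : Cube n) {k : ℕ} {m : Fin n → ℕ} (hm : ∀ i, m i < 2 ^ k) :
    (Q.dyadic k m).set ⊆ Q.set := by
  intro x hx i
  have hs := Q.side_pos
  have h2 : (0 : ℝ) < 2 ^ k := by positivity
  have h : 0 < Q.side / 2 ^ k := by positivity
  have h1 : (m i : ℝ) + 1 ≤ 2 ^ k := by exact_mod_cast hm i
  have h3 : Q.side / 2 ^ k * (m i + 1) ≤ Q.side := by
    calc _ ≤ Q.side / 2 ^ k * 2 ^ k := by gcongr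
      _ = Q.side := div_mul_cancel₀ _ h2.ne'
  have h4 : 0 ≤ Q.side / 2 ^ k * (m i : ℝ) := by positivity
  obtain ⟨h5, h6⟩ := hx i
  simp only [dyadic] at h5 h6
  constructor <;> linarith

theorem subcube_subset {Q : Cube n} {x : Fin n → ℝ} (hx : x ∈ Q.set) (k : ℕ) :
    (Q.subcube k x).set ⊆ Q.set :=
  Q.dyadic_subset (idx_lt hx k)

theorem isDyadicSub_subcube {Q : Cube n} {x : Fin n → ℝ} (hx : x ∈ Q.set) (k : ℕ) :
    Q.IsDyadicSub (Q.subcube k x) :=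
  ⟨k, _, idx_lt hx k, rfl⟩

theorem mem_subcube {Q : Cube n} {x : Fin n → ℝ} (hx : x ∈ Q.set) (k : ℕ) : x ∈ (Q.subcube k x).set :=
  (mem_dyadic_iff hx k _).2 rfl

theorem subcube_eq_of_mem {Q : Cube n} {x y : Fin n → ℝ} {k l : ℕ} (hx : x ∈ Q.set)
    (hkl : k ≤ l) (hy : y ∈ (Q.subcube l x).set) : Q.subcube k y = Q.subcube k x := by
  unfold subcube
  rw [idx_eq_of_le hkl ((mem_dyadic_iff (subcube_subset hx l hy) l _).1 hy)]

theorem subcube_anti {Q : Cube n} {x : Fin n → ℝ} {k l : ℕ} (hx : x ∈ Q.set) (hkl : k ≤ l) :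
    (Q.subcube l x).set ⊆ (Q.subcube k x).set := by
  intro y hy
  rw [← subcube_eq_of_mem hx hkl hy]
  exact mem_subcube (subcube_subset hx l hy) k

theorem subcube_zero {Q : Cube n} {x : Fin n → ℝ} (hx : x ∈ Q.set) : Q.subcube 0 x = Q := by
  have h : Q.idx 0 x = fun _ => 0 := by
    ext i
    have := idx_lt hx 0 i
    omega
  unfold subcube
  rw [h]
  simp [dyadic]

theorem volume_subcube_succ (Q : Cube n) (x : Fin n → ℝ) (k : ℕ) :
    volume (Q.subcube k x).set = 2 ^ n * volume (Q.subcube (k + 1) x).set := by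
  rw [volume_set, volume_set, ← ENNReal.ofReal_ofNat 2, ← ENNReal.ofReal_pow (by norm_num),
    ← ENNReal.ofReal_mul (by positivity), ← mul_pow]
  congr 2
  simp only [subcube, dyadic, pow_succ]
  field_simp

theorem countable_isDyadicSub (Q : Cube n) : {R | Q.IsDyadicSub R}.Countable := by
  refine (Set.countable_range fun z : ℕ × (Fin n → ℕ) => Q.dyadic z.1 z.2).mono ?_
  rintro R ⟨k, m, -, rfl⟩
  exact ⟨(k, m), rfl⟩

/-- Selection of the maximal dyadic cubes with a given property. -/
theorem exists_maximal_cubes (Q : Cube n) (P : Cube n → Prop) :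
    ∃ 𝒮 : Set (Cube n), (∀ R ∈ 𝒮, Q.IsDyadicSub R) ∧ 𝒮.PairwiseDisjoint Cube.set ∧
      (⋃ R ∈ 𝒮, R.set) = {x ∈ Q.set | ∃ k, P (Q.subcube k x)} ∧
      ∀ R ∈ 𝒮, ∃ x ∈ Q.set, ∃ k, R = Q.subcube k x ∧ P R ∧ ∀ j < k, ¬ P (Q.subcube j x) := by
  refine ⟨{R | ∃ x ∈ Q.set, ∃ k, R = Q.subcube k x ∧ P R ∧ ∀ j < k, ¬ P (Q.subcube j x)},
    ?_, ?_, ?_, fun R hR => hR⟩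
  · rintro R ⟨x, hx, k, rfl, -⟩
    exact isDyadicSub_subcube hx k
  · rintro R ⟨x, hx, k, rfl, hP, hm⟩ R' ⟨x', hx', k', rfl, hP', hm'⟩ hne
    by_contra hdis
    obtain ⟨z, hz, hz'⟩ := Set.not_disjoint_iff.1 hdis
    apply hne
    rcases lt_trichotomy k k' with h | rfl | h
    · refine absurd ?_ (hm' k h)
      rwa [← subcube_eq_of_mem hx' h.le hz', subcube_eq_of_mem hx le_rfl hz]
    · rw [← subcube_eq_of_mem hx le_rfl hz, ← subcube_eq_of_mem hx' le_rfl hz']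
    · refine absurd ?_ (hm k' h)
      rwa [← subcube_eq_of_mem hx h.le hz, subcube_eq_of_mem hx' le_rfl hz']
  · ext y
    simp only [Set.mem_iUnion, Set.mem_ofPred_eq, exists_prop]
    constructor
    · rintro ⟨R, ⟨x, hx, k, rfl, hP, -⟩, hy⟩
      refine ⟨subcube_subset hx k hy, k, ?_⟩
      rwa [subcube_eq_of_mem hx le_rfl hy]
    · rintro ⟨hy, hk⟩
      classical
      exact ⟨_, ⟨y, hy, Nat.find hk, rfl, Nat.find_spec hk, fun j hj => Nat.find_min hk hj⟩,
        mem_subcube hy _⟩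

/-- The weak type `(1,1)` estimate for the dyadic maximal function. -/
theorem mul_volume_le_lintegral (Q : Cube n) (A : Set (Fin n → ℝ)) (g : (Fin n → ℝ) → ℝ≥0∞)
    (t : ℝ≥0∞) :
    t * volume {x ∈ Q.set | ∃ k, (Q.subcube k x).set ⊆ A ∧
      t * volume (Q.subcube k x).set ≤ ∫⁻ y in (Q.subcube k x).set, g y} ≤ ∫⁻ y in A, g y := by
  obtain ⟨𝒮, hD, hdisj, hU, hP⟩ := Q.exists_maximal_cubes
    fun R => R.set ⊆ A ∧ t * volume R.set ≤ ∫⁻ y in R.set, g y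
  have hP' : ∀ R ∈ 𝒮, R.set ⊆ A ∧ t * volume R.set ≤ ∫⁻ y in R.set, g y := by
    intro R hR
    obtain ⟨x, -, k, -, h, -⟩ := hP R hR
    exact h
  have hc : 𝒮.Countable := Q.countable_isDyadicSub.mono hD
  rw [← hU]
  calc t * volume (⋃ R ∈ 𝒮, R.set) ≤ t * ∑' R : 𝒮, volume (R : Cube n).set := by
        gcongr
        exact measure_biUnion_le _ hc _
    _ = ∑' R : 𝒮, t * volume (R : Cube n).set := ENNReal.tsum_mul_left.symm
    _ ≤ ∑' R : 𝒮, ∫⁻ y in (R : Cube n).set, g y :=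
        ENNReal.tsum_le_tsum fun R => (hP' R R.2).2
    _ = ∫⁻ y in ⋃ R ∈ 𝒮, R.set, g y :=
        (lintegral_biUnion hc (fun R _ => R.measurableSet_set) hdisj g).symm
    _ ≤ ∫⁻ y in A, g y := lintegral_mono_set (Set.iUnion₂_subset fun R hR => (hP' R hR).1)

theorem ofReal_abs_ravg_sub_mul_le {R : Cube n} {f : (Fin n → ℝ) → ℝ}
    (hf : IntegrableOn f R.set) (c : ℝ) :
    ENNReal.ofReal |ravg R f - c| * volume R.set ≤ ∫⁻ x in R.set, ENNReal.ofReal |f x - c| := by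
  have hv := R.volume_set_ne_top
  have h : ∫ x in R.set, (f x - c) = (ravg R f - c) * volume.real R.set := by
    rw [integral_sub hf (integrableOn_const hv), setIntegral_const, ravg,
      ← measure_smul_setAverage f hv]
    simp only [smul_eq_mul]
    ring
  have h2 := enorm_integral_le_lintegral_enorm (μ := volume.restrict R.set) fun x => f x - c
  rw [h, enorm_mul] at h2
  simp only [Real.enorm_eq_ofReal_abs] at h2
  rwa [abs_of_nonneg measureReal_nonneg, ofReal_measureReal hv] at h2

theorem avg_mul_volume (R : Cube n) (g : (Fin n → ℝ) → ℝ) :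
    avg R g * volume R.set = ∫⁻ x in R.set, ENNReal.ofReal (g x) :=
  ENNReal.div_mul_cancel R.volume_set_ne_zero R.volume_set_ne_top

theorem tsum_avg_rpow_le {Q : Cube n} {p : ℝ} (hp : 0 < p) {f : (Fin n → ℝ) → ℝ}
    {𝒮 : Set (Cube n)} (hD : ∀ R ∈ 𝒮, Q.IsDyadicSub R) (hdisj : 𝒮.PairwiseDisjoint Cube.set) :
    ∑' R : 𝒮, avg (R : Cube n) (fun x => |f x - ravg (R : Cube n) f|) ^ p *
      volume (R : Cube n).set ≤ jnNorm Q p f ^ p * volume Q.set := by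
  rw [← ENNReal.div_le_iff Q.volume_set_ne_zero Q.volume_set_ne_top,
    ← ENNReal.rpow_inv_le_iff hp, ← one_div]
  exact le_iSup₂_of_le 𝒮 ⟨hD, hdisj⟩ le_rfl

theorem isDyadicSub_self (Q : Cube n) : Q.IsDyadicSub Q :=
  ⟨0, fun _ => 0, by simp, by simp [dyadic]⟩

theorem avg_le_jnNorm (Q : Cube n) {p : ℝ} (hp : 0 < p) (f : (Fin n → ℝ) → ℝ) :
    avg Q (fun x => |f x - ravg Q f|) ≤ jnNorm Q p f := by
  have h := tsum_avg_rpow_le (Q := Q) hp (f := f) (𝒮 := {Q})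
    (by rintro R rfl; exact R.isDyadicSub_self) (Set.pairwiseDisjoint_singleton _ _)
  rw [tsum_singleton Q fun R => avg R (fun x => |f x - ravg R f|) ^ p * volume R.set] at h
  rw [ENNReal.mul_le_mul_iff_left Q.volume_set_ne_zero Q.volume_set_ne_top] at h
  exact (ENNReal.rpow_le_rpow_iff hp).1 h

theorem le_add_mul_rpow {p s : ℝ} (hp : 1 < p) (hs : 0 < s) (a : ℝ≥0∞) :
    a ≤ ENNReal.ofReal s + ENNReal.ofReal (s ^ (1 - p)) * a ^ p := by
  have hsp : 0 < s ^ (1 - p) := Real.rpow_pos_of_pos hs _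
  rcases le_or_gt a (ENNReal.ofReal s) with h | h
  · exact h.trans le_self_add
  refine le_trans ?_ le_add_self
  induction a with
  | top =>
    rw [ENNReal.top_rpow_of_pos (by linarith), ENNReal.mul_top (by simpa using hsp)]
  | coe b =>
    have hb : s < b := by
      rwa [← ENNReal.ofReal_coe_nnreal, ENNReal.ofReal_lt_ofReal_iff_of_nonneg hs.le] at h
    have hb0 : (0 : ℝ) < b := hs.trans hb
    rw [← ENNReal.ofReal_coe_nnreal, ENNReal.ofReal_rpow_of_pos hb0,
      ← ENNReal.ofReal_mul hsp.le]
    apply ENNReal.ofReal_le_ofReal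
    have h1 : (b : ℝ) ^ (1 - p) ≤ s ^ (1 - p) :=
      Real.rpow_le_rpow_of_nonpos hs hb.le (by linarith)
    calc (b : ℝ) = b ^ (1 - p) * b ^ p := by
          rw [← Real.rpow_add hb0]; simp
      _ ≤ _ := by gcongr

/-- The set where the dyadic maximal function of `f - f_Q` exceeds `t`. -/
def level (Q : Cube n) (f : (Fin n → ℝ) → ℝ) (t : ℝ) : Set (Fin n → ℝ) :=
  {x ∈ Q.set | ∃ k, ENNReal.ofReal t * volume (Q.subcube k x).set <
    ∫⁻ y in (Q.subcube k x).set, ENNReal.ofReal |f y - ravg Q f|}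

theorem mul_volume_level_inter_le {Q : Cube n} {f : (Fin n → ℝ) → ℝ} (hf : IntegrableOn f Q.set) {t : ℝ} (ht : 0 < t)
    (hQ : ∫⁻ y in Q.set, ENNReal.ofReal |f y - ravg Q f| ≤ ENNReal.ofReal t * volume Q.set)
    {x : Fin n → ℝ} (hx : x ∈ Q.set) {k : ℕ}
    (hk : ENNReal.ofReal t * volume (Q.subcube k x).set <
      ∫⁻ y in (Q.subcube k x).set, ENNReal.ofReal |f y - ravg Q f|)
    (hmin : ∀ j < k, ∫⁻ y in (Q.subcube j x).set, ENNReal.ofReal |f y - ravg Q f| ≤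
      ENNReal.ofReal t * volume (Q.subcube j x).set) :
    ENNReal.ofReal (2 ^ n * t) * volume (Q.level f (2 ^ (n + 1) * t) ∩ (Q.subcube k x).set) ≤
      ∫⁻ y in (Q.subcube k x).set, ENNReal.ofReal |f y - ravg (Q.subcube k x) f| := by
  have h2n : (1 : ℝ) ≤ 2 ^ n := one_le_pow₀ (by norm_num)
  set R := Q.subcube k x with hR
  have hmean : ENNReal.ofReal |ravg R f - ravg Q f| ≤ ENNReal.ofReal (2 ^ n * t) := by
    rw [← ENNReal.mul_le_mul_iff_left R.volume_set_ne_zero R.volume_set_ne_top]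
    refine (ofReal_abs_ravg_sub_mul_le (hf.mono_set (subcube_subset hx k)) _).trans ?_
    rcases k with _ | j
    · rw [hR, subcube_zero hx] at hk
      exact absurd hk hQ.not_gt
    · calc ∫⁻ y in R.set, ENNReal.ofReal |f y - ravg Q f|
          ≤ ∫⁻ y in (Q.subcube j x).set, ENNReal.ofReal |f y - ravg Q f| :=
            lintegral_mono_set (subcube_anti hx j.le_succ)
        _ ≤ ENNReal.ofReal t * volume (Q.subcube j x).set := hmin j j.lt_succ_self
        _ = ENNReal.ofReal (2 ^ n * t) * volume R.set := by
            rw [volume_subcube_succ, ENNReal.ofReal_mul (by positivity),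
              ENNReal.ofReal_pow (by norm_num), ENNReal.ofReal_ofNat]
            ring
  refine le_trans ?_ (Q.mul_volume_le_lintegral R.set
    (fun y => ENNReal.ofReal |f y - ravg R f|) (ENNReal.ofReal (2 ^ n * t)))
  gcongr
  rintro z ⟨⟨hz, l, hl⟩, hzR⟩
  refine ⟨hz, l, ?_⟩
  have hkl : k ≤ l := by
    by_contra! hlk
    rw [subcube_eq_of_mem hx hlk.le hzR] at hl
    refine absurd (hl.trans_le (hmin l hlk)) (not_lt.2 ?_)
    gcongr
    nlinarith [pow_succ (2 : ℝ) n]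
  have hsub : (Q.subcube l z).set ⊆ R.set := by
    rw [hR, ← subcube_eq_of_mem hx le_rfl hzR]
    exact subcube_anti hz hkl
  refine ⟨hsub, ?_⟩
  set S := Q.subcube l z
  have h1 : ∫⁻ y in S.set, ENNReal.ofReal |f y - ravg Q f| ≤
      (∫⁻ y in S.set, ENNReal.ofReal |f y - ravg R f|) +
        ENNReal.ofReal (2 ^ n * t) * volume S.set := by
    calc ∫⁻ y in S.set, ENNReal.ofReal |f y - ravg Q f|
        ≤ ∫⁻ y in S.set, (ENNReal.ofReal |f y - ravg R f| +
            ENNReal.ofReal |ravg R f - ravg Q f|) := by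
          refine lintegral_mono fun y => ?_
          rw [← ENNReal.ofReal_add (abs_nonneg _) (abs_nonneg _)]
          exact ENNReal.ofReal_le_ofReal (abs_sub_le _ _ _)
      _ = (∫⁻ y in S.set, ENNReal.ofReal |f y - ravg R f|) +
            ENNReal.ofReal |ravg R f - ravg Q f| * volume S.set := by
          rw [lintegral_add_right _ measurable_const, setLIntegral_const]
      _ ≤ _ := by gcongr
  have h2 := hl.le.trans h1
  rw [show (2 : ℝ) ^ (n + 1) * t = 2 ^ n * t + 2 ^ n * t by ring,
    ENNReal.ofReal_add (by positivity) (by positivity), add_mul] at h2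
  exact (ENNReal.add_le_add_iff_right
    (ENNReal.mul_ne_top ENNReal.ofReal_ne_top S.volume_set_ne_top)).1 h2

theorem mul_volume_level_le {Q : Cube n} {p : ℝ} (hp : 1 < p) {f : (Fin n → ℝ) → ℝ}
    (hf : IntegrableOn f Q.set) {t s : ℝ} (ht : 0 < t) (hs : 0 < s)
    (hQ : jnNorm Q p f ≤ ENNReal.ofReal t) :
    ENNReal.ofReal (2 ^ n * t) * volume (Q.level f (2 ^ (n + 1) * t)) ≤
      ENNReal.ofReal s * volume (Q.level f t) +
        ENNReal.ofReal (s ^ (1 - p)) * (jnNorm Q p f ^ p * volume Q.set) := by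
  have hJ : ∫⁻ y in Q.set, ENNReal.ofReal |f y - ravg Q f| ≤
      ENNReal.ofReal t * volume Q.set := by
    rw [← avg_mul_volume]
    gcongr
    exact (Q.avg_le_jnNorm (by linarith) f).trans hQ
  obtain ⟨𝒮, hD, hdisj, hU, hP⟩ := Q.exists_maximal_cubes fun R =>
    ENNReal.ofReal t * volume R.set < ∫⁻ y in R.set, ENNReal.ofReal |f y - ravg Q f|
  have hc : 𝒮.Countable := Q.countable_isDyadicSub.mono hD
  have hsub : Q.level f (2 ^ (n + 1) * t) ⊆
      ⋃ R ∈ 𝒮, (Q.level f (2 ^ (n + 1) * t) ∩ R.set) := by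
    rw [← Set.inter_iUnion₂, hU]
    refine fun x hx => ⟨hx, hx.1, ?_⟩
    obtain ⟨-, k, hk⟩ := hx
    refine ⟨k, lt_of_le_of_lt ?_ hk⟩
    gcongr
    nlinarith [one_le_pow₀ (M₀ := ℝ) (n := n + 1) one_le_two]
  have hlev : volume (Q.level f t) = ∑' R : 𝒮, volume (R : Cube n).set := by
    rw [← measure_biUnion hc hdisj fun R _ => R.measurableSet_set, hU]
    rfl
  set B := Q.level f (2 ^ (n + 1) * t)
  calc ENNReal.ofReal (2 ^ n * t) * volume B
      ≤ ENNReal.ofReal (2 ^ n * t) * ∑' R : 𝒮, volume (B ∩ (R : Cube n).set) := by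
        gcongr
        exact (measure_mono hsub).trans (measure_biUnion_le _ hc _)
    _ = ∑' R : 𝒮, ENNReal.ofReal (2 ^ n * t) * volume (B ∩ (R : Cube n).set) :=
        ENNReal.tsum_mul_left.symm
    _ ≤ ∑' R : 𝒮, (ENNReal.ofReal s * volume (R : Cube n).set +
          ENNReal.ofReal (s ^ (1 - p)) *
            (avg (R : Cube n) (fun x => |f x - ravg (R : Cube n) f|) ^ p *
              volume (R : Cube n).set)) := by
        refine ENNReal.tsum_le_tsum ?_
        rintro ⟨R, hR⟩
        obtain ⟨x, hx, k, rfl, hk, hmin⟩ := hP R hR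
        refine (mul_volume_level_inter_le hf ht hJ hx hk
          fun j hj => not_lt.1 (hmin j hj)).trans ?_
        rw [← avg_mul_volume, ← mul_assoc, ← add_mul]
        gcongr
        exact le_add_mul_rpow hp hs _
    _ = ENNReal.ofReal s * volume (Q.level f t) + ENNReal.ofReal (s ^ (1 - p)) *
          ∑' R : 𝒮, avg (R : Cube n) (fun x => |f x - ravg (R : Cube n) f|) ^ p *
            volume (R : Cube n).set := by
        rw [ENNReal.tsum_add, ENNReal.tsum_mul_left, ENNReal.tsum_mul_left, hlev]
    _ ≤ _ := by
        gcongr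
        exact tsum_avg_rpow_le (by linarith) hD hdisj

theorem ae_eq_closedBall (Q : Cube n) :
    Metric.closedBall (fun i => Q.corner i + Q.side / 2) (Q.side / 2) =ᵐ[volume] Q.set := by
  rw [closedBall_pi _ (by linarith [Q.side_pos]), set_eq_pi]
  have h : ∀ i, Metric.closedBall (Q.corner i + Q.side / 2) (Q.side / 2) =
      Set.Icc (Q.corner i) (Q.corner i + Q.side) := by
    intro i
    rw [Real.closedBall_eq_Icc]
    congr 1 <;> ring
  simp_rw [h]
  rw [Set.pi_univ_Icc]
  exact Measure.univ_pi_Ico_ae_eq_Icc.symm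

/-- Lebesgue differentiation along the dyadic subcubes containing a point. -/
theorem ae_tendsto_setAverage_subcube (Q : Cube n) {f : (Fin n → ℝ) → ℝ}
    (hf : IntegrableOn f Q.set) :
    ∀ᵐ x, x ∈ Q.set →
      Tendsto (fun k => ⨍ y in (Q.subcube k x).set, f y) atTop (𝓝 (f x)) := by
  have hF : LocallyIntegrable (Q.set.indicator f) volume :=
    ((integrable_indicator_iff Q.measurableSet_set).2 hf).locallyIntegrable
  filter_upwards [IsUnifLocDoublingMeasure.ae_tendsto_average volume hF 1] with x hx hxQ
  have hside : ∀ k, (Q.subcube k x).side = Q.side * (1 / 2) ^ k := by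
    intro k
    simp [subcube, dyadic, div_eq_mul_inv]
  have hlim : Tendsto (fun k => (Q.subcube k x).side / 2) atTop (𝓝[>] 0) := by
    refine tendsto_nhdsWithin_iff.2 ⟨?_, Eventually.of_forall fun k =>
      half_pos (Q.subcube k x).side_pos⟩
    simp_rw [hside]
    have := ((tendsto_pow_atTop_nhds_zero_of_lt_one (r := (1 / 2 : ℝ)) (by norm_num)
      (by norm_num)).const_mul Q.side).div_const 2
    simpa using this
  have hmem : ∀ k, x ∈ Metric.closedBall
      (fun i => (Q.subcube k x).corner i + (Q.subcube k x).side / 2)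
      (1 * ((Q.subcube k x).side / 2)) := by
    intro k
    have hp := (Q.subcube k x).side_pos
    rw [one_mul, closedBall_pi _ (by linarith)]
    intro i _
    have := mem_subcube hxQ k i
    simp only [Real.closedBall_eq_Icc]
    constructor <;> linarith [this.1, this.2]
  have h := hx _ _ hlim (Eventually.of_forall hmem)
  rw [Set.indicator_of_mem hxQ] at h
  refine h.congr fun k => ?_
  rw [setAverage_congr (Q.subcube k x).ae_eq_closedBall]
  exact setAverage_congr_fun (Q.subcube k x).measurableSet_set
    (Eventually.of_forall fun y hy => Set.indicator_of_mem (subcube_subset hxQ k hy) f)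

theorem volume_abs_gt_le_volume_level {Q : Cube n} {f : (Fin n → ℝ) → ℝ}
    (hf : IntegrableOn f Q.set) {t : ℝ} (ht : 0 < t) :
    volume {x ∈ Q.set | ENNReal.ofReal t < ENNReal.ofReal |f x - ravg Q f|} ≤
      volume (Q.level f t) := by
  have hF : IntegrableOn (fun x => |f x - ravg Q f|) Q.set :=
    (hf.sub (integrableOn_const Q.volume_set_ne_top)).abs
  refine measure_mono_ae ?_
  filter_upwards [Q.ae_tendsto_setAverage_subcube hF] with x hx hxt
  obtain ⟨hxQ, hxt⟩ := hxt
  rw [ENNReal.ofReal_lt_ofReal_iff_of_nonneg ht.le] at hxt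
  obtain ⟨k, hk⟩ := ((hx hxQ).eventually (lt_mem_nhds hxt)).exists
  refine ⟨hxQ, k, ?_⟩
  set S := Q.subcube k x
  have hv := S.volume_set_ne_top
  have hpos : 0 < volume.real S.set := ENNReal.toReal_pos S.volume_set_ne_zero hv
  rw [← ofReal_integral_eq_lintegral_ofReal (hF.mono_set (subcube_subset hxQ k))
    (Eventually.of_forall fun y => abs_nonneg _), ← ofReal_measureReal hv,
    ← ENNReal.ofReal_mul ht.le, ENNReal.ofReal_lt_ofReal_iff_of_nonneg (by positivity),
    ← measure_smul_setAverage _ hv, smul_eq_mul, mul_comm]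
  gcongr

/-- The constant in the weak type bound for the level sets. -/
noncomputable def levelConst (n : ℕ) (p : ℝ) : ℝ :=
  ((2 : ℝ) ^ (n + 1)) ^ p +
    2 * (((2 : ℝ) ^ (n + 1)) ^ p / 2 ^ n * (2 ^ n / (2 * ((2 : ℝ) ^ (n + 1)) ^ p)) ^ (1 - p))

theorem levelConst_pos (n : ℕ) (p : ℝ) : 0 < levelConst n p := by
  unfold levelConst
  positivity

theorem rpow_mul_volume_level_le {Q : Cube n} {p : ℝ} (hp : 1 < p) {f : (Fin n → ℝ) → ℝ}
    (hf : IntegrableOn f Q.set) {T : ℝ} (hT : 0 < T) (hQ : jnNorm Q p f ≤ ENNReal.ofReal T)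
    {t : ℝ} (ht : 0 < t) :
    t ^ p * volume.real (Q.level f t) ≤ levelConst n p * (T ^ p * volume.real Q.set) := by
  have hle : ∀ t, volume (Q.level f t) ≤ volume Q.set := fun t => measure_mono fun x hx => hx.1
  have hfin : ∀ t, volume (Q.level f t) ≠ ∞ :=
    fun t => ne_top_of_le_ne_top Q.volume_set_ne_top (hle t)
  set W := volume.real Q.set
  have hW : 0 ≤ W := measureReal_nonneg
  have hTW : 0 ≤ T ^ p * W := by positivity
  have hstep : ∀ t, T ≤ t → ∀ s, 0 < s → 2 ^ n * t * volume.real (Q.level f (2 ^ (n + 1) * t)) ≤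
      s * volume.real (Q.level f t) + s ^ (1 - p) * (T ^ p * W) := by
    intro t hTt s hs
    have ht : 0 < t := hT.trans_le hTt
    have h := mul_volume_level_le hp hf ht hs (hQ.trans (ENNReal.ofReal_le_ofReal hTt))
    have h1 : jnNorm Q p f ^ p * volume Q.set ≤ ENNReal.ofReal (T ^ p * W) := by
      rw [ENNReal.ofReal_mul (by positivity), ofReal_measureReal Q.volume_set_ne_top,
        ← ENNReal.ofReal_rpow_of_pos hT]
      gcongr
    have h2 := h.trans (add_le_add_right (mul_le_mul_right h1 _) _)
    rwa [← ofReal_measureReal (hfin _), ← ofReal_measureReal (hfin t),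
      ← ENNReal.ofReal_mul (by positivity), ← ENNReal.ofReal_mul hs.le,
      ← ENNReal.ofReal_mul (by positivity), ← ENNReal.ofReal_add (by positivity) (by positivity),
      ENNReal.ofReal_le_ofReal_iff (by positivity)] at h2
  have hb : (1 : ℝ) < 2 ^ (n + 1) := one_lt_pow₀ (by norm_num) (by omega)
  have hmain : ∀ k : ℕ, ∀ t : ℝ, 0 < t → t ≤ (2 ^ (n + 1)) ^ (k + 1) * T →
      t ^ p * volume.real (Q.level f t) ≤ levelConst n p * (T ^ p * W) := by
    have hbase : ∀ t : ℝ, 0 < t → t ≤ 2 ^ (n + 1) * T →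
        t ^ p * volume.real (Q.level f t) ≤ levelConst n p * (T ^ p * W) := by
      intro t ht htT
      calc t ^ p * volume.real (Q.level f t) ≤ (2 ^ (n + 1) * T) ^ p * W := by
            gcongr
            exact ENNReal.toReal_mono Q.volume_set_ne_top (hle t)
        _ = (2 ^ (n + 1)) ^ p * (T ^ p * W) := by
            rw [Real.mul_rpow (by positivity) hT.le, mul_assoc]
        _ ≤ levelConst n p * (T ^ p * W) := by
            gcongr
            unfold levelConst
            exact le_add_of_nonneg_right (by positivity)
    intro k
    induction k with
    | zero => simpa using hbase
    | succ k ih =>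
      intro t' ht' htk
      by_cases htT : t' ≤ 2 ^ (n + 1) * T
      · exact hbase t' ht' htT
      push Not at htT
      obtain ⟨t, rfl⟩ : ∃ t, t' = 2 ^ (n + 1) * t :=
        ⟨t' / 2 ^ (n + 1), (mul_div_cancel₀ _ (by positivity)).symm⟩
      have hTt : T ≤ t := (lt_of_mul_lt_mul_left htT (by positivity)).le
      have ht : 0 < t := hT.trans_le hTt
      have hi := ih t ht (by
        rw [pow_succ' _ (k + 1), mul_assoc] at htk
        exact le_of_mul_le_mul_left htk (by positivity))
      set b : ℝ := 2 ^ (n + 1) with hbdef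
      set c : ℝ := 2 ^ n / (2 * b ^ p) with hc
      have hcpos : 0 < c := by positivity
      have hbp : 0 < b ^ p := by positivity
      have hs := hstep t hTt (c * t) (by positivity)
      have hA : levelConst n p = b ^ p + 2 * (b ^ p / 2 ^ n * c ^ (1 - p)) := rfl
      have hs2 := mul_le_mul_of_nonneg_left hs
        (show 0 ≤ b ^ p / 2 ^ n * t ^ (p - 1) by positivity)
      have htp : t ^ (p - 1) * t = t ^ p := by
        nth_rewrite 2 [← Real.rpow_one t]
        rw [← Real.rpow_add ht]; simp
      have htc : t ^ (p - 1) * (c * t) ^ (1 - p) = c ^ (1 - p) := by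
        rw [Real.mul_rpow hcpos.le ht.le, mul_left_comm, ← Real.rpow_add ht]; simp
      have hbc : b ^ p / 2 ^ n * c = 1 / 2 := by
        rw [hc]; field_simp
      set u := volume.real (Q.level f t)
      set v := volume.real (Q.level f (b * t))
      have e1 : b ^ p / 2 ^ n * t ^ (p - 1) * (2 ^ n * t * v) = (b * t) ^ p * v := by
        rw [Real.mul_rpow (by positivity) ht.le, ← htp]; field_simp
      have e2 : b ^ p / 2 ^ n * t ^ (p - 1) * (c * t * u + (c * t) ^ (1 - p) * (T ^ p * W)) =
          1 / 2 * (t ^ p * u) + b ^ p / 2 ^ n * c ^ (1 - p) * (T ^ p * W) := by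
        rw [← hbc, ← htp, ← htc]; ring
      rw [e1, e2] at hs2
      rw [hA] at hi ⊢
      nlinarith [mul_nonneg hbp.le hTW]
  obtain ⟨k, hk⟩ := pow_unbounded_of_one_lt (t / T) hb
  refine hmain k t ht ?_
  rw [div_lt_iff₀ hT] at hk
  refine hk.le.trans ?_
  gcongr
  · exact hb.le
  · omega

theorem wnorm_le_of_jnNorm_le {Q : Cube n} {p : ℝ} (hp : 1 < p) {f : (Fin n → ℝ) → ℝ}
    (hf : IntegrableOn f Q.set) {T : ℝ} (hT : 0 < T) (hQ : jnNorm Q p f ≤ ENNReal.ofReal T) :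
    wnorm Q p (fun x => ENNReal.ofReal |f x - ravg Q f|) ≤
      ENNReal.ofReal (levelConst n p ^ (1 / p)) * ENNReal.ofReal T := by
  have hp0 : 0 < p := by linarith
  have hA := levelConst_pos n p
  have hv := Q.volume_set_ne_top
  refine iSup₂_le fun t ht => ?_
  have hfin : volume (Q.level f t) ≠ ∞ :=
    ne_top_of_le_ne_top hv (measure_mono fun x hx => hx.1)
  have hpos : 0 < volume.real Q.set := ENNReal.toReal_pos Q.volume_set_ne_zero hv
  have h := rpow_mul_volume_level_le hp hf hT hQ ht
  calc _ ≤ ENNReal.ofReal t * (volume (Q.level f t) / volume Q.set) ^ (1 / p) := by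
        have hl := volume_abs_gt_le_volume_level hf ht
        gcongr ENNReal.ofReal t * (?_ / _) ^ (1 / p)
    _ = ENNReal.ofReal (t * (volume.real (Q.level f t) / volume.real Q.set) ^ (1 / p)) := by
        rw [← ofReal_measureReal hfin, ← ofReal_measureReal hv,
          ← ENNReal.ofReal_div_of_pos hpos,
          ENNReal.ofReal_rpow_of_nonneg (by positivity) (by positivity),
          ← ENNReal.ofReal_mul ht.le]
    _ ≤ ENNReal.ofReal (levelConst n p ^ (1 / p) * T) := by
        apply ENNReal.ofReal_le_ofReal
        rw [← Real.rpow_le_rpow_iff (by positivity) (by positivity) hp0,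
          Real.mul_rpow ht.le (by positivity), Real.mul_rpow (by positivity) hT.le,
          ← Real.rpow_mul (by positivity), ← Real.rpow_mul hA.le,
          one_div_mul_cancel hp0.ne', Real.rpow_one, Real.rpow_one, ← mul_div_assoc,
          div_le_iff₀ hpos, mul_assoc]
        exact h
    _ = _ := ENNReal.ofReal_mul (by positivity)

end Cube

/-- **Embedding of the dyadic John–Nirenberg space into weak `L^p`.** -/
theorem jnNorm_embedding (n : ℕ) (p : ℝ) (hp : 1 < p) :
    ∃ C : ℝ, 0 < C ∧
      ∀ (Q : Cube n) (f : (Fin n → ℝ) → ℝ), Measurable f → IntegrableOn f Q.set →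
        Cube.wnorm Q p (fun x => ENNReal.ofReal |f x - Cube.ravg Q f|)
          ≤ ENNReal.ofReal C * Cube.jnNorm Q p f := by

  have hA := Cube.levelConst_pos n p
  refine ⟨Cube.levelConst n p ^ (1 / p), by positivity, fun Q f _ hf => ?_⟩
  rcases eq_or_ne (Cube.jnNorm Q p f) ∞ with h | h
  · rw [h, ENNReal.mul_top (by simpa using Real.rpow_pos_of_pos hA _)]
    exact le_top
  have hlim : Tendsto (fun ε : ℝ => ENNReal.ofReal (Cube.levelConst n p ^ (1 / p)) *
      ENNReal.ofReal ((Cube.jnNorm Q p f).toReal + ε)) (𝓝[>] 0)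
      (𝓝 (ENNReal.ofReal (Cube.levelConst n p ^ (1 / p)) * Cube.jnNorm Q p f)) := by
    refine ENNReal.Tendsto.const_mul ?_ (Or.inr ENNReal.ofReal_ne_top)
    have hc : Continuous fun ε : ℝ => ENNReal.ofReal ((Cube.jnNorm Q p f).toReal + ε) := by
      exact ENNReal.continuous_ofReal.comp (by fun_prop)
    have := hc.tendsto 0
    rw [add_zero, ENNReal.ofReal_toReal h] at this
    exact this.mono_left nhdsWithin_le_nhds
  refine ge_of_tendsto hlim ?_
  filter_upwards [self_mem_nhdsWithin] with ε hε
  have hε : 0 < ε := hε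
  refine Cube.wnorm_le_of_jnNorm_le hp hf (by positivity) ?_
  exact ENNReal.le_ofReal_iff_toReal_le h (by positivity) |>.2 (by linarith)
end

section
/- Let (X,d,μ) be a metric measure space with μ a Borel regular doubling measure and fix η > 0. Given 1 < p < ∞, 0 < ρ ≤ 1 and τ ≥ 1, there exists a constant C, depending only on p, τ, η, ρ and μ, such that for every ball B ⊂ X and every f ∈ L^ρ(τB̂), ‖f − f_B‖_{L^{p,∞},B} ≤ C‖f‖_{JN^ρ_{p,τ},τB̂}. -/
open MeasureTheory Filter
open scoped ENNReal NNReal Topology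

/-- A (metric) ball, which comes with a center and a positive finite radius. -/
structure MBall (X : Type*) where
  center : X
  radius : ℝ
  radius_pos : 0 < radius

namespace MBall

variable {X : Type*} [MetricSpace X] [MeasurableSpace X]

/-- The underlying set of the ball. -/
def set (B : MBall X) : Set X := Metric.ball B.center B.radius

/-- The `t`-dilate `tB` of the ball `B`. -/
def dilate (B : MBall X) (t : ℝ) (ht : 0 < t) : MBall X :=
  ⟨B.center, t * B.radius, mul_pos ht B.radius_pos⟩

/-- `B̂ := (1+η)B`. -/
def hat (B : MBall X) (η : ℝ) (hη : 0 < η) : MBall X :=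
  B.dilate (1 + η) (by linarith)

/-- The family `𝓑 = 𝓑_{B₀} = {B(x_B,r_B) : x_B ∈ B₀, r_B ≤ η r_{B₀}}`. -/
def fam (B₀ : MBall X) (η : ℝ) : Set (MBall X) :=
  {B | B.center ∈ Metric.ball B₀.center B₀.radius ∧ B.radius ≤ η * B₀.radius}

/-- The `μ`-average `(1/μ(B))∫_B f dμ` of a nonnegative function, valued in `ℝ≥0∞`. -/
noncomputable def avg (μ : Measure X) (B : MBall X) (f : X → ℝ) : ℝ≥0∞ :=
  (∫⁻ x in B.set, ENNReal.ofReal (f x) ∂μ) / μ B.set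

/-- The real-valued `μ`-average `f_B = (1/μ(B))∫_B f dμ`. -/
noncomputable def ravg (μ : Measure X) (B : MBall X) (f : X → ℝ) : ℝ :=
  ⨍ x in B.set, f x ∂μ

/-- The maximal operator `M_𝓑` with respect to the basis `𝓑 = 𝓑_{B₀}`
(zero where no ball of the family contains the point). -/
noncomputable def maximal (μ : Measure X) (B₀ : MBall X) (η : ℝ) (f : X → ℝ) (x : X) :
    ℝ≥0∞ :=
  ⨆ (B : MBall X) (_ : B ∈ fam B₀ η ∧ x ∈ B.set), avg μ B f

/-- `G*_𝓑(x) = sup { g(B) : B ∈ 𝓑, x ∈ B }` (zero where no ball of the family contains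
the point). -/
noncomputable def gstar (B₀ : MBall X) (η : ℝ) (g : MBall X → ℝ) (x : X) : ℝ≥0∞ :=
  ⨆ (B : MBall X) (_ : B ∈ fam B₀ η ∧ x ∈ B.set), ENNReal.ofReal (g B)

/-- The normalized weak `L^p` (quasi-)norm on a ball, for an `ℝ≥0∞`-valued function. -/
noncomputable def wnorm (μ : Measure X) (B : MBall X) (p : ℝ) (f : X → ℝ≥0∞) : ℝ≥0∞ :=
  ⨆ (t : ℝ) (_ : 0 < t),
    ENNReal.ofReal t * (μ {x ∈ B.set | ENNReal.ofReal t < f x} / μ B.set) ^ (1 / p)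

/-- The normalized `L^p` norm `((1/μ(B))∫_B f^p dμ)^{1/p}` for an `ℝ≥0∞`-valued function. -/
noncomputable def lpnorm (μ : Measure X) (B : MBall X) (p : ℝ) (f : X → ℝ≥0∞) : ℝ≥0∞ :=
  ((∫⁻ x in B.set, f x ^ p ∂μ) / μ B.set) ^ (1 / p)

/-- `inf_{c ∈ ℝ} (1/μ(B)) ∫_B |f-c|^ρ dμ`. -/
noncomputable def oscInf (μ : Measure X) (ρ : ℝ) (B : MBall X) (f : X → ℝ) : ℝ≥0∞ :=
  ⨅ c : ℝ, (∫⁻ x in B.set, ENNReal.ofReal (|f x - c| ^ ρ) ∂μ) / μ B.set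

/-- The John–Nirenberg functional `‖f‖_{JN^ρ_{p,τ},B}`: the supremum over all families of
balls `{B_i}` with `{τ B_i}` pairwise disjoint and `τ B_i ⊆ B` of
`((1/μ(B)) Σ_i (inf_c ⨍_{B_i} |f-c|^ρ dμ)^{p/ρ} μ(τ B_i))^{1/p}`. -/
noncomputable def jnNorm (μ : Measure X) (p ρ τ : ℝ) (hτ : 0 < τ) (B : MBall X)
    (f : X → ℝ) : ℝ≥0∞ :=
  ⨆ (I : Set (MBall X)) (_ : (∀ Bi ∈ I, (MBall.dilate Bi τ hτ).set ⊆ B.set) ∧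
      I.PairwiseDisjoint (fun Bi => (MBall.dilate Bi τ hτ).set)),
    ((∑' Bi : I, oscInf μ ρ (Bi : MBall X) f ^ (p / ρ) *
        μ ((MBall.dilate (Bi : MBall X) τ hτ).set)) / μ B.set) ^ (1 / p)

/-- `‖a‖_{D_p,B}` for an (extended) nonnegative functional `a` on balls. -/
noncomputable def dpNorm (μ : Measure X) (p : ℝ) (B : MBall X) (a : MBall X → ℝ≥0∞) :
    ℝ≥0∞ :=
  (⨆ (I : Set (MBall X)) (_ : (∀ Bi ∈ I, (Bi : MBall X).set ⊆ B.set) ∧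
      I.PairwiseDisjoint MBall.set),
    ((∑' Bi : I, a (Bi : MBall X) ^ p * μ (Bi : MBall X).set) / μ B.set) ^ (1 / p)) / a B

/-- `‖a‖_{D_p(B₀)} = sup_{B ⊆ B₀} ‖a‖_{D_p,B}`. -/
noncomputable def dpGlobal (μ : Measure X) (p : ℝ) (B₀ : MBall X) (a : MBall X → ℝ≥0∞) :
    ℝ≥0∞ :=
  ⨆ (B : MBall X) (_ : B.set ⊆ B₀.set), dpNorm μ p B a

end MBall

namespace MBall

variable {X : Type*} [MetricSpace X]

theorem dilate_one_set (B : MBall X) : (B.dilate 1 one_pos).set = B.set := by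
  simp [set, dilate]

theorem set_subset_dilate (B : MBall X) {t : ℝ} (ht : 1 ≤ t) :
    B.set ⊆ (B.dilate t (one_pos.trans_le ht)).set :=
  Metric.ball_subset_ball (le_mul_of_one_le_left B.radius_pos.le ht)

theorem center_mem (B : MBall X) : B.center ∈ B.set := Metric.mem_ball_self B.radius_pos

theorem measurableSet_set [MeasurableSpace X] [BorelSpace X] (B : MBall X) : MeasurableSet B.set :=
  Metric.isOpen_ball.measurableSet

/-- A ball centered in `B` of radius at most `η r_B`, dilated by `τ ≥ 1`, lies in `τ B̂`. -/
theorem dilate_subset_of_mem_fam {B Q : MBall X} {η τ : ℝ} (hη : 0 < η) (hτ : 1 ≤ τ)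
    (hQ : Q ∈ fam B η) :
    (Q.dilate τ (one_pos.trans_le hτ)).set ⊆
      ((B.hat η hη).dilate τ (one_pos.trans_le hτ)).set := by
  obtain ⟨h1, h2⟩ := hQ
  refine Metric.ball_subset_ball' ?_
  have h3 : dist Q.center B.center < B.radius := h1
  have h4 : B.radius ≤ τ * B.radius := le_mul_of_one_le_left B.radius_pos.le hτ
  have h5 : τ * Q.radius ≤ τ * (η * B.radius) := by gcongr
  simp only [dilate, hat]
  nlinarith

theorem set_subset_hat_of_mem_fam {B Q : MBall X} {η : ℝ} (hη : 0 < η) (hQ : Q ∈ fam B η) :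
    Q.set ⊆ (B.hat η hη).set := by
  have := dilate_subset_of_mem_fam hη le_rfl hQ
  rwa [dilate_one_set, dilate_one_set] at this

variable [MeasurableSpace X]

theorem tsum_measure_le [BorelSpace X] {μ : Measure X} {U : Set (MBall X)} {g : MBall X → MBall X}
    {W : Set X} (hU : U.PairwiseDisjoint fun B => (g B).set) (hW : ∀ B ∈ U, (g B).set ⊆ W) :
    ∑' B : U, μ (g B).set ≤ μ W := by
  refine (tsum_meas_le_meas_iUnion_of_disjoint μ (fun B : U => (g B).measurableSet_set) ?_).trans
    (measure_mono (Set.iUnion_subset fun B => hW B B.2))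
  intro a b hab
  exact hU a.2 b.2 fun h => hab (Subtype.ext h)

/-- A Vitali covering lemma for dilates of open balls inside a set of finite measure. -/
theorem exists_disjoint_subfamily [BorelSpace X] {μ : Measure X} (hpos : ∀ B : MBall X, 0 < μ B.set)
    (T : Set (MBall X)) {k : ℝ} (hk : 0 < k) {R : ℝ} (hR : ∀ B ∈ T, B.radius ≤ R)
    {W : Set X} (hW : μ W ≠ ⊤) (hTW : ∀ B ∈ T, (B.dilate k hk).set ⊆ W) :
    ∃ U ⊆ T, U.Countable ∧ U.PairwiseDisjoint (fun B => (B.dilate k hk).set) ∧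
      ∀ B ∈ T, ∃ B' ∈ U,
        (B.dilate k hk).set ⊆ ((B'.dilate k hk).dilate 5 (by norm_num)).set := by
  obtain ⟨U, hUT, hdisj, hcov⟩ := Vitali.exists_disjoint_subfamily_covering_enlargement
    (fun B : MBall X => (B.dilate k hk).set) T MBall.radius 2 one_lt_two
    (fun B _ => B.radius_pos.le) R hR (fun B _ => ⟨_, (B.dilate k hk).center_mem⟩)
  refine ⟨U, hUT, ?_, hdisj, fun B hB => ?_⟩
  · have hsum : ∑' B : U, μ ((B : MBall X).dilate k hk).set ≠ ⊤ :=
      ((tsum_measure_le hdisj fun B hB => hTW B (hUT hB)).trans_lt hW.lt_top).ne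
    have := Summable.countable_support_ennreal hsum
    rw [Function.support_eq_univ fun B : U => (hpos _).ne', Set.countable_univ_iff] at this
    exact this
  · obtain ⟨B', hB', ⟨z, hz, hz'⟩, hr⟩ := hcov B hB
    refine ⟨B', hB', Metric.ball_subset_ball' ?_⟩
    have h1 : dist z B.center < k * B.radius := hz
    have h2 : dist z B'.center < k * B'.radius := hz'
    have h3 := dist_triangle_left B.center B'.center z
    have h4 : k * B.radius ≤ k * (2 * B'.radius) := by gcongr
    simp only [dilate]
    nlinarith

/-- The weak type `(1,1)` inequality for a family of balls inside a set of finite measure. -/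
theorem mul_measure_biUnion_le [BorelSpace X] {μ : Measure X} (hpos : ∀ B : MBall X, 0 < μ B.set)
    {c : ℝ≥0∞} (hc : ∀ B : MBall X, μ (B.dilate 5 (by norm_num)).set ≤ c * μ B.set)
    {T : Set (MBall X)} {R : ℝ} (hR : ∀ B ∈ T, B.radius ≤ R) {W : Set X} (hW : μ W ≠ ⊤)
    (hTW : ∀ B ∈ T, B.set ⊆ W) {l : ℝ≥0∞} {v : X → ℝ≥0∞}
    (hl : ∀ B ∈ T, l * μ B.set ≤ ∫⁻ x in B.set, v x ∂μ) :
    l * μ (⋃ B ∈ T, B.set) ≤ c * ∫⁻ x in W, v x ∂μ := by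
  obtain ⟨U, hUT, hUc, hdisj, hcov⟩ := exists_disjoint_subfamily hpos T one_pos hR hW
    (fun B hB => by rw [dilate_one_set]; exact hTW B hB)
  have hsub : (⋃ B ∈ T, B.set) ⊆ ⋃ B ∈ U, ((B.dilate 1 one_pos).dilate 5 (by norm_num)).set := by
    refine Set.iUnion₂_subset fun B hB => ?_
    obtain ⟨B', hB', h⟩ := hcov B hB
    rw [dilate_one_set] at h
    exact h.trans (Set.subset_biUnion_of_mem (u := fun B : MBall X =>
      ((B.dilate 1 one_pos).dilate 5 (by norm_num)).set) hB')
  have hmeas : ∀ B : MBall X, μ ((B.dilate 1 one_pos).dilate 5 (by norm_num)).set ≤ c * μ B.set :=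
    fun B => (hc _).trans_eq (by rw [dilate_one_set])
  have := hUc.to_subtype
  calc l * μ (⋃ B ∈ T, B.set)
      ≤ l * ∑' B : U, μ (((B : MBall X).dilate 1 one_pos).dilate 5 (by norm_num)).set := by
        gcongr
        exact (measure_mono hsub).trans (measure_biUnion_le μ hUc _)
    _ ≤ l * ∑' B : U, c * μ (B : MBall X).set := by
        gcongr with B
        exact hmeas B
    _ = c * ∑' B : U, l * μ (B : MBall X).set := by
        rw [ENNReal.tsum_mul_left, ENNReal.tsum_mul_left]; ring
    _ ≤ c * ∑' B : U, ∫⁻ x in (B : MBall X).set, v x ∂μ := by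
        gcongr with B
        exact hl B (hUT B.2)
    _ = c * ∫⁻ x in ⋃ B : U, (B : MBall X).set, v x ∂μ := by
        rw [lintegral_iUnion (fun B : U => (B : MBall X).measurableSet_set)]
        intro a b hab
        have := hdisj a.2 b.2 fun h => hab (Subtype.ext h)
        simpa only [Function.onFun, dilate_one_set] using this
    _ ≤ c * ∫⁻ x in W, v x ∂μ := by
        gcongr
        exact Set.iUnion_subset fun B => hTW B (hUT B.2)

/-- The union of the balls of a family on which the average of `u` exceeds `l`. -/
def levelSet (μ : Measure X) (F : Set (MBall X)) (u : X → ℝ≥0∞) (l : ℝ≥0∞) : Set X :=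
  ⋃ Q ∈ {Q ∈ F | l * μ Q.set < ∫⁻ x in Q.set, u x ∂μ}, Q.set

theorem isOpen_levelSet (μ : Measure X) (F : Set (MBall X)) (u : X → ℝ≥0∞) (l : ℝ≥0∞) :
    IsOpen (levelSet μ F u l) :=
  isOpen_biUnion fun _ _ => Metric.isOpen_ball

/-- A substitute for the Lebesgue differentiation theorem. -/
theorem measure_lt_le_measure_levelSet [BorelSpace X] {μ : Measure X} [μ.Regular]
    (hpos : ∀ B : MBall X, 0 < μ B.set) (hfin : ∀ B : MBall X, μ B.set < ⊤)
    {c : ℝ≥0∞} (hc0 : c ≠ 0) (hc1 : c ≠ ⊤)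
    (hc : ∀ B : MBall X, μ (B.dilate 5 (by norm_num)).set ≤ c * μ B.set)
    {η : ℝ} (hη : 0 < η) (B : MBall X) {u : X → ℝ≥0∞} (hu : Measurable u)
    {l : ℝ≥0∞} (hl0 : l ≠ 0) (hl1 : l ≠ ⊤) :
    μ {x ∈ B.set | 2 * c * l < u x} ≤ μ (levelSet μ (fam B η) u l) := by
  set E := levelSet μ (fam B η) u l with hE
  set S := {x ∈ B.set | 2 * c * l < u x} \ E with hS
  have hSm : MeasurableSet S :=
    (B.measurableSet_set.inter (measurableSet_lt measurable_const hu)).diff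
      (isOpen_levelSet μ _ u l).measurableSet
  have hSB : S ⊆ B.set := fun x hx => hx.1.1
  suffices h : μ S = 0 by
    calc μ {x ∈ B.set | 2 * c * l < u x} ≤ μ (E ∪ S) := measure_mono fun x hx => by
          by_cases hxE : x ∈ E
          · exact Or.inl hxE
          · exact Or.inr ⟨hx, hxE⟩
      _ ≤ μ E + μ S := measure_union_le _ _
      _ = μ E := by rw [h, add_zero]
  by_contra hS0
  have hSfin : μ S ≠ ⊤ := ((measure_mono hSB).trans_lt (hfin B)).ne
  obtain ⟨V, hSV, hVo, hV⟩ := Set.exists_isOpen_lt_of_lt S (2 * μ S) (by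
    rw [two_mul]; exact ENNReal.lt_add_right hSfin hS0)
  have hVfin : μ V ≠ ⊤ := hV.ne_top
  let T : Set (MBall X) :=
    {Q | Q.center ∈ S ∧ Q.dilate 5 (by norm_num) ∈ fam B η ∧ Q.set ⊆ V}
  obtain ⟨U, hUT, hUc, hdisj, hcov⟩ := exists_disjoint_subfamily hpos T one_pos
    (R := η * B.radius) (W := V) (fun Q hQ => by
      have h1 : 5 * Q.radius ≤ η * B.radius := hQ.2.1.2
      have := Q.radius_pos
      linarith) hVfin
    (fun Q hQ => by rw [dilate_one_set]; exact hQ.2.2)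
  have hsub : S ⊆ ⋃ Q : U, ((Q : MBall X).dilate 5 (by norm_num)).set := by
    intro x hx
    obtain ⟨ε, hε, hεV⟩ := Metric.isOpen_iff.1 hVo x (hSV hx)
    have hr : 0 < min ε (η * B.radius / 5) :=
      lt_min hε (div_pos (mul_pos hη B.radius_pos) (by norm_num))
    obtain ⟨Q, hQ, h⟩ := hcov ⟨x, _, hr⟩ ⟨hx, ⟨hSB hx, by
      have := min_le_right ε (η * B.radius / 5)
      simp only [dilate]
      linarith⟩, (Metric.ball_subset_ball (min_le_left _ _)).trans hεV⟩
    refine Set.mem_iUnion.2 ⟨⟨Q, hQ⟩, ?_⟩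
    have := h (center_mem _)
    simpa [dilate, set] using this
  have hsmall : ∀ Q : U, ∫⁻ x in ((Q : MBall X).dilate 5 (by norm_num)).set, u x ∂μ ≤
      l * (c * μ (Q : MBall X).set) := by
    rintro ⟨Q, hQ⟩
    have hQT := hUT hQ
    have : ∫⁻ x in (Q.dilate 5 (by norm_num)).set, u x ∂μ ≤
        l * μ (Q.dilate 5 (by norm_num)).set := by
      by_contra! hlt
      exact hQT.1.2 (Set.mem_biUnion (x := Q.dilate 5 (by norm_num)) ⟨hQT.2.1, hlt⟩
        (center_mem (Q.dilate 5 (by norm_num))))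
    exact this.trans (by gcongr; exact hc Q)
  have := hUc.to_subtype
  have hlower : 2 * c * l * μ S ≤ ∫⁻ x in S, u x ∂μ := by
    rw [← setLIntegral_const]
    exact setLIntegral_mono' hSm fun x hx => hx.1.2.le
  have hupper : ∫⁻ x in S, u x ∂μ ≤ c * l * μ V :=
    calc ∫⁻ x in S, u x ∂μ
        ≤ ∫⁻ x in ⋃ Q : U, ((Q : MBall X).dilate 5 (by norm_num)).set, u x ∂μ :=
          lintegral_mono_set hsub
      _ ≤ ∑' Q : U, ∫⁻ x in ((Q : MBall X).dilate 5 (by norm_num)).set, u x ∂μ :=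
          lintegral_iUnion_le _ _
      _ ≤ ∑' Q : U, l * (c * μ (Q : MBall X).set) := ENNReal.tsum_le_tsum hsmall
      _ = c * l * ∑' Q : U, μ (Q : MBall X).set := by
          rw [ENNReal.tsum_mul_left, ENNReal.tsum_mul_left]; ring
      _ ≤ c * l * μ V := by
          gcongr
          refine tsum_measure_le (g := fun Q => Q) ?_ fun Q hQ => (hUT hQ).2.2
          simpa only [dilate_one_set] using hdisj
  have hlt : c * l * μ V < c * l * (2 * μ S) :=
    ENNReal.mul_lt_mul_right (mul_ne_zero hc0 hl0) (ENNReal.mul_ne_top hc1 hl1) hV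
  refine (hlower.trans hupper).not_gt (hlt.trans_eq (by ring))

theorem ofReal_abs_sub_rpow_le {ρ : ℝ} (hρ0 : 0 < ρ) (hρ1 : ρ ≤ 1) (a b c : ℝ) :
    ENNReal.ofReal (|a - c| ^ ρ) ≤
      ENNReal.ofReal (|a - b| ^ ρ) + ENNReal.ofReal (|b - c| ^ ρ) := by
  simp only [← ENNReal.ofReal_rpow_of_nonneg (abs_nonneg _) hρ0.le]
  refine le_trans ?_ (ENNReal.rpow_add_le_add_rpow _ _ hρ0.le hρ1)
  rw [← ENNReal.ofReal_add (abs_nonneg _) (abs_nonneg _)]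
  gcongr
  exact abs_sub_le a b c

/-- Stopping time: a ball of the family on which the average of `u` exceeds `l` is contained in
a ball of the family with the same property whose fivefold dilate no longer has it. -/
theorem exists_stopping {μ : Measure X} {B : MBall X} {η : ℝ} {u : X → ℝ≥0∞} {l : ℝ≥0∞}
    (hlarge : ∀ Q ∈ fam B η, η * B.radius < 5 * Q.radius →
      ∫⁻ x in Q.set, u x ∂μ ≤ l * μ Q.set)
    {Q : MBall X} (hQ : Q ∈ fam B η) (hl : l * μ Q.set < ∫⁻ x in Q.set, u x ∂μ) :
    ∃ P ∈ fam B η, Q.set ⊆ P.set ∧ l * μ P.set < ∫⁻ x in P.set, u x ∂μ ∧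
      P.dilate 5 (by norm_num) ∈ fam B η ∧
      ∫⁻ x in (P.dilate 5 (by norm_num)).set, u x ∂μ ≤
        l * μ (P.dilate 5 (by norm_num)).set := by
  let D : ℕ → MBall X := fun n => Q.dilate (5 ^ n) (by positivity)
  have hD0 : D 0 = Q := by simp [D, dilate]
  have hDs : ∀ n, D (n + 1) = (D n).dilate 5 (by norm_num) := fun n => by
    simp only [D, dilate, MBall.mk.injEq, true_and]; ring
  let p : ℕ → Prop := fun n => D n ∈ fam B η ∧
    l * μ (D n).set < ∫⁻ x in (D n).set, u x ∂μ
  obtain ⟨n, hn, hn'⟩ : ∃ n, p n ∧ ¬ p (n + 1) := by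
    by_contra! hcon
    have hall : ∀ n, p n := fun n => by
      induction n with
      | zero => exact ⟨by rwa [hD0], by rwa [hD0]⟩
      | succ n ih => exact hcon n ih
    obtain ⟨n, hn⟩ := pow_unbounded_of_one_lt (η * B.radius / Q.radius)
      (show (1 : ℝ) < 5 by norm_num)
    rw [div_lt_iff₀ Q.radius_pos] at hn
    exact hn.not_ge (hall n).1.2
  have hfam : (D n).dilate 5 (by norm_num) ∈ fam B η := by
    refine ⟨hn.1.1, ?_⟩
    by_contra! hcon
    exact (hlarge _ hn.1 hcon).not_gt hn.2
  refine ⟨D n, hn.1, set_subset_dilate Q (one_le_pow₀ (by norm_num)), hn.2, hfam, ?_⟩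
  by_contra! hcon
  exact hn' ⟨by rwa [hDs], by rwa [hDs]⟩

/-- The balls with large oscillation cover a set of controlled measure. -/
theorem rpow_mul_measure_biUnion_le [BorelSpace X] {μ : Measure X}
    (hpos : ∀ B : MBall X, 0 < μ B.set) {c : ℝ≥0∞}
    (hc : ∀ B : MBall X, μ (B.dilate 5 (by norm_num)).set ≤ c * μ B.set)
    {W : Set X} (hW : μ W ≠ ⊤) {τ : ℝ} (hτ : 1 ≤ τ) {a : MBall X → ℝ≥0∞} {q : ℝ} (hq : 0 < q)
    {A : ℝ≥0∞}
    (hA : ∀ I : Set (MBall X), (∀ Q ∈ I, (Q.dilate τ (one_pos.trans_le hτ)).set ⊆ W) →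
      I.PairwiseDisjoint (fun Q => (Q.dilate τ (one_pos.trans_le hτ)).set) →
      ∑' Q : I, a Q ^ q * μ ((Q : MBall X).dilate τ (one_pos.trans_le hτ)).set ≤ A)
    {T : Set (MBall X)} {R : ℝ} (hR : ∀ Q ∈ T, Q.radius ≤ R)
    (hT : ∀ Q ∈ T, (Q.dilate τ (one_pos.trans_le hτ)).set ⊆ W)
    {θ : ℝ≥0∞} (hθ : ∀ Q ∈ T, θ ≤ a Q) :
    θ ^ q * μ (⋃ Q ∈ T, Q.set) ≤ c * A := by
  obtain ⟨U, hUT, hUc, hdisj, hcov⟩ :=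
    exists_disjoint_subfamily hpos T (one_pos.trans_le hτ) hR hW hT
  have hsub : (⋃ Q ∈ T, Q.set) ⊆
      ⋃ Q ∈ U, ((Q.dilate τ (one_pos.trans_le hτ)).dilate 5 (by norm_num)).set := by
    refine Set.iUnion₂_subset fun Q hQ => ?_
    obtain ⟨Q', hQ', h⟩ := hcov Q hQ
    exact (set_subset_dilate Q hτ).trans (h.trans (Set.subset_biUnion_of_mem
      (u := fun Q : MBall X =>
        ((Q.dilate τ (one_pos.trans_le hτ)).dilate 5 (by norm_num)).set) hQ'))
  calc θ ^ q * μ (⋃ Q ∈ T, Q.set)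
      ≤ θ ^ q * ∑' Q : U,
          μ (((Q : MBall X).dilate τ (one_pos.trans_le hτ)).dilate 5 (by norm_num)).set := by
        gcongr
        exact (measure_mono hsub).trans (measure_biUnion_le μ hUc _)
    _ = ∑' Q : U, θ ^ q *
          μ (((Q : MBall X).dilate τ (one_pos.trans_le hτ)).dilate 5 (by norm_num)).set :=
        ENNReal.tsum_mul_left.symm
    _ ≤ ∑' Q : U, a Q ^ q *
          (c * μ ((Q : MBall X).dilate τ (one_pos.trans_le hτ)).set) := by
        gcongr with Q
        · exact hθ Q (hUT Q.2)
        · exact hc _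
    _ = c * ∑' Q : U, a Q ^ q * μ ((Q : MBall X).dilate τ (one_pos.trans_le hτ)).set := by
        rw [← ENNReal.tsum_mul_left]
        congr 1 with Q
        ring
    _ ≤ c * A := by
        gcongr
        exact hA U (fun Q hQ => hT Q (hUT hQ)) hdisj

/-- Inside a ball `Q` with small oscillation and controlled average, the averages of
`|f - c₀| ^ ρ` exceed `4 l` only on a small set. -/
theorem mul_measure_biUnion_le_of_oscInf_le [BorelSpace X] {μ : Measure X}
    (hpos : ∀ B : MBall X, 0 < μ B.set) (hfin : ∀ B : MBall X, μ B.set < ⊤) {c : ℝ≥0∞}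
    (hc : ∀ B : MBall X, μ (B.dilate 5 (by norm_num)).set ≤ c * μ B.set)
    {ρ : ℝ} (hρ0 : 0 < ρ) (hρ1 : ρ ≤ 1) {f : X → ℝ} (hf : Measurable f) {c₀ : ℝ}
    {l θ : ℝ≥0∞} (hl : l ≠ ⊤) (hθ : θ ≠ 0) (hθl : 2 * θ ≤ l) {Q : MBall X}
    (hosc : oscInf μ ρ Q f ≤ θ)
    (hQ : ∫⁻ x in Q.set, ENNReal.ofReal (|f x - c₀| ^ ρ) ∂μ ≤ l * μ Q.set)
    {T : Set (MBall X)} {R : ℝ} (hR : ∀ P ∈ T, P.radius ≤ R) (hTQ : ∀ P ∈ T, P.set ⊆ Q.set)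
    (hT : ∀ P ∈ T, 4 * l * μ P.set < ∫⁻ x in P.set, ENNReal.ofReal (|f x - c₀| ^ ρ) ∂μ) :
    l * μ (⋃ P ∈ T, P.set) ≤ c * θ * μ Q.set := by
  have hθ' : θ ≠ ⊤ := fun h => hl (top_le_iff.1 (by simpa [h] using hθl))
  have hlt : oscInf μ ρ Q f < 2 * θ :=
    hosc.trans_lt (by rw [two_mul]; exact ENNReal.lt_add_right hθ' hθ)
  obtain ⟨b, hb⟩ := iInf_lt_iff.1 hlt
  have hb : ∫⁻ x in Q.set, ENNReal.ofReal (|f x - b| ^ ρ) ∂μ ≤ 2 * θ * μ Q.set :=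
    (ENNReal.div_le_iff (hpos Q).ne' (hfin Q).ne).1 hb.le
  have hmeas : ∀ a : ℝ, Measurable fun x => ENNReal.ofReal (|f x - a| ^ ρ) := fun a => by
    fun_prop
  have hbc : ENNReal.ofReal (|b - c₀| ^ ρ) ≤ 2 * l := by
    refine (ENNReal.mul_le_mul_iff_left (hpos Q).ne' (hfin Q).ne).1 ?_
    calc ENNReal.ofReal (|b - c₀| ^ ρ) * μ Q.set
        = ∫⁻ _ in Q.set, ENNReal.ofReal (|b - c₀| ^ ρ) ∂μ := (setLIntegral_const _ _).symm
      _ ≤ ∫⁻ x in Q.set, (ENNReal.ofReal (|f x - b| ^ ρ) + ENNReal.ofReal (|f x - c₀| ^ ρ)) ∂μ :=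
          lintegral_mono fun x => by
            have := ofReal_abs_sub_rpow_le hρ0 hρ1 b (f x) c₀
            rwa [abs_sub_comm b (f x)] at this
      _ ≤ 2 * θ * μ Q.set + l * μ Q.set := by
          rw [lintegral_add_left (hmeas b)]
          exact add_le_add hb hQ
      _ ≤ l * μ Q.set + l * μ Q.set := by gcongr
      _ = 2 * l * μ Q.set := by ring
  have hkey : ∀ P ∈ T, 2 * l * μ P.set ≤ ∫⁻ x in P.set, ENNReal.ofReal (|f x - b| ^ ρ) ∂μ := by
    intro P hP
    have htop : 2 * l * μ P.set ≠ ⊤ :=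
      ENNReal.mul_ne_top (ENNReal.mul_ne_top ENNReal.ofNat_ne_top hl) (hfin P).ne
    refine (ENNReal.add_le_add_iff_right htop).1 ?_
    calc 2 * l * μ P.set + 2 * l * μ P.set
        = 4 * l * μ P.set := by ring
      _ ≤ ∫⁻ x in P.set, ENNReal.ofReal (|f x - c₀| ^ ρ) ∂μ := (hT P hP).le
      _ ≤ ∫⁻ x in P.set, (ENNReal.ofReal (|f x - b| ^ ρ) + 2 * l) ∂μ :=
          lintegral_mono fun x => (ofReal_abs_sub_rpow_le hρ0 hρ1 (f x) b c₀).trans (by gcongr)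
      _ = ∫⁻ x in P.set, ENNReal.ofReal (|f x - b| ^ ρ) ∂μ + 2 * l * μ P.set := by
          rw [lintegral_add_left (hmeas b), setLIntegral_const]
  have := mul_measure_biUnion_le hpos hc hR (hfin Q).ne hTQ hkey
  refine (ENNReal.mul_le_mul_iff_right two_ne_zero ENNReal.ofNat_ne_top).1 ?_
  calc 2 * (l * μ (⋃ P ∈ T, P.set)) = 2 * l * μ (⋃ P ∈ T, P.set) := by ring
    _ ≤ c * (2 * θ * μ Q.set) := this.trans (by gcongr)
    _ = 2 * (c * θ * μ Q.set) := by ring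

/-- The good-`λ` inequality. -/
theorem measure_levelSet_le [BorelSpace X] {μ : Measure X}
    (hpos : ∀ B : MBall X, 0 < μ B.set) (hfin : ∀ B : MBall X, μ B.set < ⊤) {c : ℝ≥0∞}
    (hc : ∀ B : MBall X, μ (B.dilate 5 (by norm_num)).set ≤ c * μ B.set)
    {η ρ τ q : ℝ} (hη : 0 < η) (hρ0 : 0 < ρ) (hρ1 : ρ ≤ 1) (hτ : 1 ≤ τ) (hq : 0 < q)
    {B : MBall X} {f : X → ℝ} (hf : Measurable f) {c₀ : ℝ} {A : ℝ≥0∞}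
    (hA : ∀ I : Set (MBall X), (∀ Q ∈ I, (Q.dilate τ (one_pos.trans_le hτ)).set ⊆
        ((B.hat η hη).dilate τ (one_pos.trans_le hτ)).set) →
      I.PairwiseDisjoint (fun Q => (Q.dilate τ (one_pos.trans_le hτ)).set) →
      ∑' Q : I, oscInf μ ρ Q f ^ q *
        μ ((Q : MBall X).dilate τ (one_pos.trans_le hτ)).set ≤ A)
    {l θ : ℝ≥0∞} (hl : l ≠ ⊤) (hθ : θ ≠ 0) (hθl : 2 * θ ≤ l)
    (hlarge : ∀ Q ∈ fam B η, η * B.radius < 5 * Q.radius →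
      ∫⁻ x in Q.set, ENNReal.ofReal (|f x - c₀| ^ ρ) ∂μ ≤ l * μ Q.set) :
    μ (levelSet μ (fam B η) (fun x => ENNReal.ofReal (|f x - c₀| ^ ρ)) (4 * l)) ≤
      c ^ 2 * (θ / l) * μ (levelSet μ (fam B η) (fun x => ENNReal.ofReal (|f x - c₀| ^ ρ)) l) +
        c * (A / θ ^ q) := by
  have hl0 : l ≠ 0 := fun h => hθ (by simpa [h] using hθl)
  have hθ' : θ ≠ ⊤ := fun h => hl (top_le_iff.1 (by simpa [h] using hθl))
  set u : X → ℝ≥0∞ := fun x => ENNReal.ofReal (|f x - c₀| ^ ρ) with hu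
  let T : Set (MBall X) := {P ∈ fam B η | l * μ P.set < ∫⁻ x in P.set, u x ∂μ ∧
      P.dilate 5 (by norm_num) ∈ fam B η ∧
      ∫⁻ x in (P.dilate 5 (by norm_num)).set, u x ∂μ ≤
        l * μ (P.dilate 5 (by norm_num)).set}
  obtain ⟨U, hUT, hUc, hdisj, hcov⟩ := exists_disjoint_subfamily hpos T one_pos
    (fun Q hQ => hQ.1.2) (hfin (B.hat η hη)).ne
    (fun Q hQ => by rw [dilate_one_set]; exact set_subset_hat_of_mem_fam hη hQ.1)
  simp only [dilate_one_set] at hdisj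
  let U₁ : Set (MBall X) := {P ∈ U | oscInf μ ρ (P.dilate 5 (by norm_num)) f ≤ θ}
  let T₂ : Set (MBall X) := {Q ∈ fam B η | θ ≤ oscInf μ ρ Q f}
  let G : MBall X → Set (MBall X) := fun P =>
    {Q ∈ fam B η | 4 * l * μ Q.set < ∫⁻ x in Q.set, u x ∂μ ∧
      Q.set ⊆ (P.dilate 5 (by norm_num)).set}
  have hsub : levelSet μ (fam B η) u (4 * l) ⊆
      (⋃ P ∈ U₁, ⋃ Q ∈ G P, Q.set) ∪ ⋃ Q ∈ T₂, Q.set := by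
    refine Set.iUnion₂_subset fun Q hQ => ?_
    have hlQ : l * μ Q.set < ∫⁻ x in Q.set, u x ∂μ := by
      refine lt_of_le_of_lt ?_ hQ.2
      gcongr
      exact le_mul_of_one_le_left' (by norm_num)
    obtain ⟨P, hP, hQP, hP1, hP2, hP3⟩ := exists_stopping hlarge hQ.1 hlQ
    obtain ⟨P', hP', hPP'⟩ := hcov P ⟨hP, hP1, hP2, hP3⟩
    have hQP' : Q.set ⊆ (P'.dilate 5 (by norm_num)).set := by
      refine hQP.trans ?_
      rw [dilate_one_set] at hPP'
      simpa [dilate] using hPP'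
    rcases le_total (oscInf μ ρ (P'.dilate 5 (by norm_num)) f) θ with h | h
    · refine subset_trans (fun x hx => ?_) Set.subset_union_left
      exact Set.mem_biUnion (x := P') ⟨hP', h⟩ (Set.mem_biUnion (x := Q) ⟨hQ.1, hQ.2, hQP'⟩ hx)
    · refine subset_trans (fun x hx => ?_) Set.subset_union_right
      exact Set.mem_biUnion (x := P'.dilate 5 (by norm_num)) ⟨(hUT hP').2.2.1, h⟩ (hQP' hx)
  have hbad : μ (⋃ Q ∈ T₂, Q.set) ≤ c * (A / θ ^ q) := by
    have := rpow_mul_measure_biUnion_le hpos hc (hfin _).ne hτ hq hA (T := T₂)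
      (fun Q hQ => hQ.1.2) (fun Q hQ => dilate_subset_of_mem_fam hη hτ hQ.1)
      (fun Q hQ => hQ.2)
    rw [← mul_div_assoc, ENNReal.le_div_iff_mul_le
      (Or.inl (ENNReal.rpow_pos (pos_iff_ne_zero.2 hθ) hθ').ne')
      (Or.inl (ENNReal.rpow_ne_top_of_nonneg hq.le hθ')), mul_comm]
    exact this
  have hgood : ∀ P ∈ U₁, μ (⋃ Q ∈ G P, Q.set) ≤ c ^ 2 * (θ / l) * μ P.set := by
    intro P hP
    have h1 := mul_measure_biUnion_le_of_oscInf_le hpos hfin hc hρ0 hρ1 hf hl hθ hθl hP.2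
      (hUT hP.1).2.2.2 (T := G P) (fun Q hQ => hQ.1.2) (fun Q hQ => hQ.2.2) (fun Q hQ => hQ.2.1)
    have h2 : l * μ (⋃ Q ∈ G P, Q.set) ≤ c ^ 2 * θ * μ P.set :=
      h1.trans ((mul_le_mul_right (hc P) _).trans_eq (by ring))
    have h3 : c ^ 2 * (θ / l) * μ P.set = c ^ 2 * θ * μ P.set / l := by
      simp only [div_eq_mul_inv]; ring
    rwa [h3, ENNReal.le_div_iff_mul_le (Or.inl hl0) (Or.inl hl), mul_comm]
  have hU₁c : U₁.Countable := hUc.mono (Set.sep_subset _ _)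
  refine (measure_mono hsub).trans ((measure_union_le _ _).trans (add_le_add ?_ hbad))
  calc μ (⋃ P ∈ U₁, ⋃ Q ∈ G P, Q.set)
      ≤ ∑' P : U₁, μ (⋃ Q ∈ G P, Q.set) := measure_biUnion_le μ hU₁c _
    _ ≤ ∑' P : U₁, c ^ 2 * (θ / l) * μ (P : MBall X).set :=
        ENNReal.tsum_le_tsum fun P => hgood P P.2
    _ = c ^ 2 * (θ / l) * ∑' P : U₁, μ (P : MBall X).set := ENNReal.tsum_mul_left
    _ ≤ c ^ 2 * (θ / l) * μ (levelSet μ (fam B η) u l) := by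
        gcongr
        refine tsum_measure_le (g := fun Q => Q) (hdisj.subset (Set.sep_subset _ _)) ?_
        exact fun Q hQ => Set.subset_biUnion_of_mem (u := MBall.set)
          (show Q ∈ {Q ∈ fam B η | l * μ Q.set < ∫⁻ x in Q.set, u x ∂μ} from
            ⟨(hUT hQ.1).1, (hUT hQ.1).2.1⟩)

theorem le_geometric_of_recurrence {m : ℕ → ℝ≥0∞} {M : ℝ≥0∞} {a ε G : ℝ} (ha : 0 < a)
    (hG : 0 ≤ G) (hε : ε ≤ a / 2) (h0 : m 0 ≤ M)
    (hm : ∀ n, m (n + 1) ≤ ENNReal.ofReal ε * m n + ENNReal.ofReal (G * a ^ n) * M) (n : ℕ) :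
    m n ≤ ENNReal.ofReal ((1 + 2 * G / a) * a ^ n) * M := by
  induction n with
  | zero =>
    refine h0.trans (le_mul_of_one_le_left' ?_)
    rw [ENNReal.one_le_ofReal, pow_zero, mul_one]
    exact le_add_of_nonneg_right (by positivity)
  | succ n ih =>
    calc m (n + 1) ≤ ENNReal.ofReal (a / 2) * (ENNReal.ofReal ((1 + 2 * G / a) * a ^ n) * M) +
          ENNReal.ofReal (G * a ^ n) * M := (hm n).trans (by gcongr)
      _ = ENNReal.ofReal (a / 2 * ((1 + 2 * G / a) * a ^ n) + G * a ^ n) * M := by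
          rw [ENNReal.ofReal_add (by positivity) (by positivity),
            ENNReal.ofReal_mul (p := a / 2) (by positivity)]
          ring
      _ ≤ ENNReal.ofReal ((1 + 2 * G / a) * a ^ (n + 1)) * M := by
          gcongr
          have : 0 < a ^ n * a := by positivity
          have h2 : (1 + 2 * G / a) * a ^ (n + 1) -
              (a / 2 * ((1 + 2 * G / a) * a ^ n) + G * a ^ n) = a ^ n * a / 2 := by
            field_simp
            ring
          linarith

theorem tsum_le_of_jnNorm_le {μ : Measure X} (hpos : ∀ B : MBall X, 0 < μ B.set)
    (hfin : ∀ B : MBall X, μ B.set < ⊤) {p ρ τ K : ℝ} (hp : 0 < p) (hτ : 0 < τ) (hK : 0 ≤ K)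
    {W : MBall X} {f : X → ℝ} (h : jnNorm μ p ρ τ hτ W f ≤ ENNReal.ofReal K)
    (I : Set (MBall X)) (hI : ∀ Q ∈ I, (Q.dilate τ hτ).set ⊆ W.set)
    (hI' : I.PairwiseDisjoint (fun Q => (Q.dilate τ hτ).set)) :
    ∑' Q : I, oscInf μ ρ Q f ^ (p / ρ) * μ ((Q : MBall X).dilate τ hτ).set ≤
      ENNReal.ofReal (K ^ p) * μ W.set := by
  have h1 := (le_iSup₂ (f := fun (I : Set (MBall X))
    (_ : (∀ Bi ∈ I, (MBall.dilate Bi τ hτ).set ⊆ W.set) ∧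
      I.PairwiseDisjoint (fun Bi => (MBall.dilate Bi τ hτ).set)) =>
    ((∑' Bi : I, oscInf μ ρ (Bi : MBall X) f ^ (p / ρ) *
        μ ((MBall.dilate (Bi : MBall X) τ hτ).set)) / μ W.set) ^ (1 / p)) I ⟨hI, hI'⟩).trans h
  rw [one_div, ENNReal.rpow_inv_le_iff hp, ENNReal.ofReal_rpow_of_nonneg hK hp.le,
    ENNReal.div_le_iff (hpos W).ne' (hfin W).ne] at h1
  exact h1

theorem oscInf_le_of_jnNorm_le {μ : Measure X} (hpos : ∀ B : MBall X, 0 < μ B.set)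
    (hfin : ∀ B : MBall X, μ B.set < ⊤) {p ρ τ K : ℝ} (hp : 0 < p) (hρ : 0 < ρ) (hτ : 0 < τ)
    (hK : 0 ≤ K) {W : MBall X} {f : X → ℝ}
    (h : jnNorm μ p ρ τ hτ (W.dilate τ hτ) f ≤ ENNReal.ofReal K) :
    oscInf μ ρ W f ≤ ENNReal.ofReal (K ^ ρ) := by
  have h1 := tsum_le_of_jnNorm_le hpos hfin hp hτ hK h {W} (by simp) (by simp)
  rw [tsum_singleton W (fun Q => oscInf μ ρ Q f ^ (p / ρ) * μ (Q.dilate τ hτ).set),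
    ENNReal.mul_le_mul_iff_left (hpos _).ne' (hfin _).ne,
    ← ENNReal.le_rpow_inv_iff (by positivity),
    ENNReal.ofReal_rpow_of_nonneg (by positivity) (by positivity), ← Real.rpow_mul hK] at h1
  convert h1 using 3
  field_simp

/-- The weak type estimate with respect to some constant `c₀` in place of the average. -/
theorem exists_measure_lt_abs_sub_le [BorelSpace X] (μ : Measure X) [μ.Regular] {cμ D : ℝ}
    (hcμ : 0 < cμ)
    (hdoubling : ∀ B B' : MBall X, B.set ⊆ B'.set → B.radius ≤ B'.radius →
      μ B'.set ≤ ENNReal.ofReal (cμ * (B'.radius / B.radius) ^ D) * μ B.set)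
    (hD : 0 < D)
    (hpos : ∀ B : MBall X, 0 < μ B.set) (hfin : ∀ B : MBall X, μ B.set < ⊤)
    {η p ρ τ : ℝ} (hη : 0 < η) (hp : 0 < p) (hρ0 : 0 < ρ) (hρ1 : ρ ≤ 1) (hτ : 1 ≤ τ) :
    ∃ C : ℝ, 0 < C ∧ ∀ (B : MBall X) (f : X → ℝ), Measurable f → ∀ K : ℝ, 0 < K →
      jnNorm μ p ρ τ (one_pos.trans_le hτ) ((B.hat η hη).dilate τ (one_pos.trans_le hτ)) f ≤
        ENNReal.ofReal K →
      ∃ c₀ : ℝ, ∀ t : ℝ, 0 < t →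
        μ {x ∈ B.set | t < |f x - c₀|} ≤ ENNReal.ofReal (C * (K / t) ^ p) * μ B.set := by
  have hτ0 : 0 < τ := one_pos.trans_le hτ
  obtain ⟨q, hq⟩ : ∃ q, q = p / ρ := ⟨_, rfl⟩
  have hq0 : 0 < q := hq ▸ div_pos hp hρ0
  have hρq : ρ * q = p := by rw [hq]; field_simp
  obtain ⟨c, hcdef⟩ : ∃ c, c = cμ * 5 ^ D := ⟨_, rfl⟩
  have hc0 : 0 < c := by rw [hcdef]; positivity
  obtain ⟨a, hadef⟩ : ∃ a : ℝ, a = 4 ^ (-q) := ⟨_, rfl⟩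
  have ha0 : 0 < a := by rw [hadef]; positivity
  obtain ⟨γ, hγdef⟩ : ∃ γ, γ = min (1 / 2) (a / (2 * c ^ 2)) := ⟨_, rfl⟩
  have hγ0 : 0 < γ := by rw [hγdef]; exact lt_min (by norm_num) (by positivity)
  have hγ1 : 2 * γ ≤ 1 := by
    have := min_le_left (1 / 2) (a / (2 * c ^ 2))
    rw [← hγdef] at this
    linarith
  have hγ2 : c ^ 2 * γ ≤ a / 2 := by
    have := min_le_right (1 / 2) (a / (2 * c ^ 2))
    rw [← hγdef, le_div_iff₀ (by positivity)] at this
    linarith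
  obtain ⟨L, hLdef⟩ : ∃ L, L = 2 * (cμ * (5 * (1 + η) / η) ^ D) := ⟨_, rfl⟩
  have hL0 : 0 < L := by rw [hLdef]; positivity
  obtain ⟨G, hGdef⟩ : ∃ G, G = c * ((γ * L) ^ q)⁻¹ := ⟨_, rfl⟩
  have hG0 : 0 < G := by rw [hGdef]; positivity
  obtain ⟨H, hHdef⟩ : ∃ H, H = 1 + 2 * G / a := ⟨_, rfl⟩
  have hH0 : 0 < H := by rw [hHdef]; positivity
  obtain ⟨E, hEdef⟩ : ∃ E, E = cμ * (τ * (1 + η)) ^ D := ⟨_, rfl⟩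
  have hE0 : 0 < E := by rw [hEdef]; positivity
  have ha_pow : ∀ n : ℕ, a ^ n = (((4 : ℝ) ^ n) ^ q)⁻¹ := fun n => by
    rw [hadef, Real.rpow_neg (by norm_num), inv_pow, ← Real.rpow_natCast, ← Real.rpow_natCast,
      ← Real.rpow_mul (by norm_num), ← Real.rpow_mul (by norm_num), mul_comm]
  have hc : ∀ B : MBall X, μ (B.dilate 5 (by norm_num)).set ≤ ENNReal.ofReal c * μ B.set := by
    intro B
    have h := hdoubling B (B.dilate 5 (by norm_num)) (set_subset_dilate B (by norm_num))
      (le_mul_of_one_le_left B.radius_pos.le (by norm_num))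
    simp only [dilate, mul_div_cancel_right₀ _ B.radius_pos.ne'] at h
    rwa [← hcdef] at h
  refine ⟨(H * E * 4 ^ q + 1) * (2 * c * L) ^ q, by positivity, fun B f hf K hK hjn => ?_⟩
  set M := μ ((B.hat η hη).dilate τ hτ0).set with hM
  have hMB : M ≤ ENNReal.ofReal E * μ B.set := by
    have h1 : 1 ≤ τ * (1 + η) := one_le_mul_of_one_le_of_one_le hτ (by linarith)
    have h := hdoubling B ((B.hat η hη).dilate τ hτ0)
      ((set_subset_dilate B (by linarith : 1 ≤ 1 + η)).trans (set_subset_dilate _ hτ))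
      (by
        simp only [dilate, hat, ← mul_assoc]
        exact le_mul_of_one_le_left B.radius_pos.le h1)
    have hratio : ((B.hat η hη).dilate τ hτ0).radius / B.radius = τ * (1 + η) := by
      simp only [dilate, hat, ← mul_assoc, mul_div_cancel_right₀ _ B.radius_pos.ne']
    rwa [hratio, ← hEdef] at h
  obtain ⟨κ, hκdef⟩ : ∃ κ, κ = K ^ ρ := ⟨_, rfl⟩
  have hκ0 : 0 < κ := by rw [hκdef]; positivity
  have hκq : κ ^ q = K ^ p := by rw [hκdef, ← Real.rpow_mul hK.le, hρq]
  have hosc : oscInf μ ρ (B.hat η hη) f < ENNReal.ofReal (2 * κ) := by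
    refine (oscInf_le_of_jnNorm_le hpos hfin hp hρ0 hτ0 hK.le hjn).trans_lt ?_
    rw [← hκdef]
    exact (ENNReal.ofReal_lt_ofReal_iff (by positivity)).2 (by linarith)
  obtain ⟨c₀, hc₀⟩ := iInf_lt_iff.1 hosc
  have hc₀ := (ENNReal.div_le_iff (hpos _).ne' (hfin _).ne).1 hc₀.le
  refine ⟨c₀, fun t ht => ?_⟩
  set u : X → ℝ≥0∞ := fun x => ENNReal.ofReal (|f x - c₀| ^ ρ) with hu
  have hum : Measurable u := by fun_prop
  have hlarge : ∀ Q ∈ fam B η, η * B.radius < 5 * Q.radius →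
      ∫⁻ x in Q.set, u x ∂μ ≤ ENNReal.ofReal (L * κ) * μ Q.set := by
    intro Q hQ hQr
    have hB0 := B.radius_pos
    have hQ0 := Q.radius_pos
    have hsub := set_subset_hat_of_mem_fam hη hQ
    have h1 := hdoubling Q (B.hat η hη) hsub (by
      have := hQ.2
      simp only [hat, dilate]
      linarith)
    have h2 : (B.hat η hη).radius / Q.radius ≤ 5 * (1 + η) / η := by
      simp only [hat, dilate]
      rw [div_le_div_iff₀ hQ0 hη]
      nlinarith
    have h3 : 0 ≤ (B.hat η hη).radius / Q.radius :=
      div_nonneg (B.hat η hη).radius_pos.le hQ0.le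
    calc ∫⁻ x in Q.set, u x ∂μ ≤ ∫⁻ x in (B.hat η hη).set, u x ∂μ := lintegral_mono_set hsub
      _ ≤ ENNReal.ofReal (2 * κ) *
          (ENNReal.ofReal (cμ * (5 * (1 + η) / η) ^ D) * μ Q.set) :=
          hc₀.trans (by gcongr; exact h1.trans (by gcongr))
      _ = ENNReal.ofReal (L * κ) * μ Q.set := by
          rw [← mul_assoc, ← ENNReal.ofReal_mul (by positivity), hLdef]
          congr 2
          ring
  have hdecay : ∀ n : ℕ, μ (levelSet μ (fam B η) u (ENNReal.ofReal (4 ^ n * (L * κ)))) ≤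
      ENNReal.ofReal (H * a ^ n) * M := by
    rw [hHdef]
    refine le_geometric_of_recurrence ha0 hG0.le hγ2 (measure_mono ?_) fun n => ?_
    · exact Set.iUnion₂_subset fun Q hQ =>
        (set_subset_hat_of_mem_fam hη hQ.1).trans (set_subset_dilate _ hτ)
    · have hl0 : 0 < 4 ^ n * (L * κ) := by positivity
      have h := measure_levelSet_le hpos hfin hc hη hρ0 hρ1 hτ hq0 (B := B) hf (c₀ := c₀)
        (hq ▸ tsum_le_of_jnNorm_le hpos hfin hp hτ0 hK.le hjn)
        (l := ENNReal.ofReal (4 ^ n * (L * κ)))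
        (θ := ENNReal.ofReal (γ * (4 ^ n * (L * κ)))) ENNReal.ofReal_ne_top
        (by simpa using by positivity)
        (by
          rw [← ENNReal.ofReal_ofNat 2, ← ENNReal.ofReal_mul (by norm_num), ← mul_assoc]
          exact ENNReal.ofReal_le_ofReal (mul_le_of_le_one_left hl0.le hγ1))
        (fun Q hQ hQr => (hlarge Q hQ hQr).trans (mul_le_mul_left (ENNReal.ofReal_le_ofReal
          (le_mul_of_one_le_left (by positivity) (one_le_pow₀ (by norm_num : (1 : ℝ) ≤ 4)))) _))
      have e1 : (4 : ℝ≥0∞) * ENNReal.ofReal (4 ^ n * (L * κ)) =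
          ENNReal.ofReal (4 ^ (n + 1) * (L * κ)) := by
        rw [← ENNReal.ofReal_ofNat 4, ← ENNReal.ofReal_mul (by norm_num)]
        congr 1
        ring
      have e2 : ENNReal.ofReal c ^ 2 * (ENNReal.ofReal (γ * (4 ^ n * (L * κ))) /
          ENNReal.ofReal (4 ^ n * (L * κ))) = ENNReal.ofReal (c ^ 2 * γ) := by
        rw [← ENNReal.ofReal_div_of_pos hl0, mul_div_cancel_right₀ _ hl0.ne',
          ← ENNReal.ofReal_pow hc0.le, ← ENNReal.ofReal_mul (by positivity)]
      have e3 : ENNReal.ofReal c * (ENNReal.ofReal (K ^ p) * M /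
          ENNReal.ofReal (γ * (4 ^ n * (L * κ))) ^ q) = ENNReal.ofReal (G * a ^ n) * M := by
        have e4 : G * a ^ n = c * (K ^ p / (γ * (4 ^ n * (L * κ))) ^ q) := by
          rw [show γ * (4 ^ n * (L * κ)) = γ * L * 4 ^ n * κ by ring,
            Real.mul_rpow (by positivity) hκ0.le, Real.mul_rpow (by positivity) (by positivity),
            hκq, hGdef, ha_pow]
          field_simp
        rw [e4, ENNReal.ofReal_mul hc0.le, ENNReal.ofReal_div_of_pos (by positivity),
          ENNReal.ofReal_rpow_of_nonneg (by positivity) hq0.le]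
        simp only [div_eq_mul_inv]
        ring
      rwa [e1, e2, e3] at h
  have hs0 : 0 < 2 * c * L := by positivity
  rcases lt_or_ge (t ^ ρ) (2 * c * (L * κ)) with hsmall | hbig
  · refine (measure_mono (Set.sep_subset _ _)).trans (le_mul_of_one_le_left' ?_)
    rw [ENNReal.one_le_ofReal]
    have h1 : t ^ p ≤ (2 * c * L) ^ q * K ^ p := by
      rw [← hκq, ← Real.mul_rpow hs0.le hκ0.le, ← hρq, Real.rpow_mul ht.le]
      exact Real.rpow_le_rpow (by positivity) (by linarith) hq0.le
    have h2 : 1 ≤ (2 * c * L) ^ q * (K / t) ^ p := by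
      rw [Real.div_rpow hK.le ht.le, ← mul_div_assoc, one_le_div (by positivity)]
      exact h1
    have h3 : 0 ≤ H * E * 4 ^ q * ((2 * c * L) ^ q * (K / t) ^ p) := by positivity
    linarith
  · obtain ⟨n, hn1, hn2⟩ := exists_nat_pow_near (one_le_div (by positivity) |>.2 hbig)
      (show (1 : ℝ) < 4 by norm_num)
    rw [le_div_iff₀ (by positivity)] at hn1
    rw [div_lt_iff₀ (by positivity)] at hn2
    have hsub : {x ∈ B.set | t < |f x - c₀|} ⊆
        {x ∈ B.set | 2 * ENNReal.ofReal c * ENNReal.ofReal (4 ^ n * (L * κ)) < u x} := by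
      rintro x ⟨hx, hxt⟩
      refine ⟨hx, ?_⟩
      rw [← ENNReal.ofReal_ofNat 2, ← ENNReal.ofReal_mul (by norm_num),
        ← ENNReal.ofReal_mul (by positivity)]
      refine (ENNReal.ofReal_lt_ofReal_iff (by
        have := ht.trans hxt
        positivity)).2 ?_
      calc 2 * c * (4 ^ n * (L * κ)) = 4 ^ n * (2 * c * (L * κ)) := by ring
        _ ≤ t ^ ρ := hn1
        _ < |f x - c₀| ^ ρ := Real.rpow_lt_rpow ht.le hxt hρ0
    have hlevel := measure_lt_le_measure_levelSet hpos hfin (c := ENNReal.ofReal c)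
      (by simpa using hc0) ENNReal.ofReal_ne_top hc hη B hum
      (l := ENNReal.ofReal (4 ^ n * (L * κ))) (by simpa using by positivity)
      ENNReal.ofReal_ne_top
    have han : a ^ n ≤ 4 ^ q * (2 * c * L) ^ q * (K / t) ^ p := by
      rw [ha_pow, Real.div_rpow hK.le ht.le, ← hκq, ← hρq, Real.rpow_mul ht.le,
        ← Real.mul_rpow (by norm_num) hs0.le, ← mul_div_assoc,
        ← Real.mul_rpow (by positivity) hκ0.le, inv_le_iff_one_le_mul₀ (by positivity),
        div_mul_eq_mul_div, one_le_div (by positivity),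
        ← Real.mul_rpow (by positivity) (by positivity)]
      refine Real.rpow_le_rpow (by positivity) (hn2.le.trans_eq ?_) hq0.le
      ring
    calc μ {x ∈ B.set | t < |f x - c₀|}
        ≤ ENNReal.ofReal (H * a ^ n) * M := (measure_mono hsub).trans (hlevel.trans (hdecay n))
      _ ≤ ENNReal.ofReal (H * a ^ n) * (ENNReal.ofReal E * μ B.set) := by gcongr
      _ = ENNReal.ofReal (H * E * a ^ n) * μ B.set := by
          rw [← mul_assoc, ← ENNReal.ofReal_mul (by positivity)]
          congr 2
          ring
      _ ≤ _ := by
          refine mul_le_mul_left (ENNReal.ofReal_le_ofReal ?_) _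
          have h1 : H * E * a ^ n ≤ H * E * (4 ^ q * (2 * c * L) ^ q * (K / t) ^ p) := by
            gcongr
          have h2 : 0 ≤ (2 * c * L) ^ q * (K / t) ^ p := by positivity
          linarith

/-- A function in weak `L^p` with `p > 1` is integrable. -/
theorem lintegral_le_of_measure_lt_le {α : Type*} [MeasurableSpace α] {ν : Measure α} {g : α → ℝ}
    (hg : Measurable g) (hg0 : 0 ≤ g) {p C K : ℝ} (hp : 1 < p) (hC : 0 ≤ C) (hK : 0 < K)
    (h : ∀ t : ℝ, 0 < t → ν {x | t < g x} ≤ ENNReal.ofReal (C * (K / t) ^ p) * ν Set.univ) :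
    ∫⁻ x, ENNReal.ofReal (g x) ∂ν ≤ ENNReal.ofReal ((1 + C / (p - 1)) * K) * ν Set.univ := by
  have hp1 : 0 < p - 1 := by linarith
  rw [lintegral_eq_lintegral_meas_lt ν (Eventually.of_forall hg0) hg.aemeasurable,
    ← Set.Ioc_union_Ioi_eq_Ioi hK.le]
  refine (lintegral_union_le _ _ _).trans ?_
  have h1 : ∫⁻ t in Set.Ioc 0 K, ν {x | t < g x} ≤ ENNReal.ofReal K * ν Set.univ :=
    calc ∫⁻ t in Set.Ioc 0 K, ν {x | t < g x} ≤ ∫⁻ _ in Set.Ioc 0 K, ν Set.univ :=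
          lintegral_mono fun t => measure_mono (Set.subset_univ _)
      _ = ENNReal.ofReal K * ν Set.univ := by
          rw [setLIntegral_const, Real.volume_Ioc, sub_zero, mul_comm]
  have hint : IntegrableOn (fun t : ℝ => C * K ^ p * t ^ (-p)) (Set.Ioi K) :=
    (integrableOn_Ioi_rpow_of_lt (by linarith) hK).const_mul _
  have hval : ∫ t in Set.Ioi K, C * K ^ p * t ^ (-p) = C / (p - 1) * K := by
    rw [integral_const_mul, integral_Ioi_rpow_of_lt (by linarith) hK,
      show -K ^ (-p + 1) / (-p + 1) = K ^ (-p + 1) / (p - 1) by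
        rw [show -p + 1 = -(p - 1) by ring, neg_div_neg_eq],
      mul_div_assoc', mul_assoc, ← Real.rpow_add hK, show p + (-p + 1) = 1 by ring, Real.rpow_one]
    ring
  have h2 : ∫⁻ t in Set.Ioi K, ν {x | t < g x} ≤ ENNReal.ofReal (C / (p - 1) * K) * ν Set.univ :=
    calc ∫⁻ t in Set.Ioi K, ν {x | t < g x}
        ≤ ∫⁻ t in Set.Ioi K, ENNReal.ofReal (C * K ^ p * t ^ (-p)) * ν Set.univ := by
          refine setLIntegral_mono' measurableSet_Ioi fun t (ht : K < t) => ?_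
          have ht0 : 0 < t := hK.trans ht
          refine (h t ht0).trans_eq ?_
          rw [Real.div_rpow hK.le ht0.le, Real.rpow_neg ht0.le, mul_assoc, ← div_eq_mul_inv]
      _ = ENNReal.ofReal (C / (p - 1) * K) * ν Set.univ := by
          rw [lintegral_mul_const _ (by fun_prop), ← ofReal_integral_eq_lintegral_ofReal hint, hval]
          refine (ae_restrict_mem measurableSet_Ioi).mono fun t (ht : K < t) => ?_
          have ht0 : 0 < t := hK.trans ht
          simp only [Pi.zero_apply]
          positivity
  refine (add_le_add h1 h2).trans_eq ?_
  rw [← add_mul, ← ENNReal.ofReal_add hK.le (by positivity)]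
  congr 2
  ring

theorem abs_ravg_sub_le [BorelSpace X] {μ : Measure X} {B : MBall X} (hpos : 0 < μ B.set)
    (hfin : μ B.set < ⊤) {f : X → ℝ} (hf : Measurable f) {c₀ A : ℝ} (hA : 0 ≤ A)
    (h : ∫⁻ x in B.set, ENNReal.ofReal |f x - c₀| ∂μ ≤ ENNReal.ofReal A * μ B.set) :
    |ravg μ B f - c₀| ≤ A := by
  have := Fact.mk hfin
  have hreal : 0 < μ.real B.set := ENNReal.toReal_pos hpos.ne' hfin.ne
  have hint : Integrable (fun x => f x - c₀) (μ.restrict B.set) := by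
    refine ⟨(hf.sub_const _).aestronglyMeasurable, ?_⟩
    rw [hasFiniteIntegral_iff_norm]
    exact h.trans_lt (ENNReal.mul_lt_top ENNReal.ofReal_lt_top hfin)
  have havg : ravg μ B f - c₀ = (μ.real B.set)⁻¹ * ∫ x in B.set, (f x - c₀) ∂μ := by
    have hfint : Integrable f (μ.restrict B.set) :=
      (hint.add (integrable_const c₀)).congr (Filter.Eventually.of_forall fun x => by simp)
    rw [ravg, setAverage_eq, integral_sub hfint (integrable_const _), setIntegral_const]
    simp only [smul_eq_mul]
    field_simp
  have hbound : |∫ x in B.set, (f x - c₀) ∂μ| ≤ A * μ.real B.set := by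
    rw [← Real.norm_eq_abs]
    refine (norm_integral_le_lintegral_norm _).trans ?_
    refine (ENNReal.toReal_mono (ENNReal.mul_lt_top ENNReal.ofReal_lt_top hfin).ne h).trans_eq ?_
    rw [ENNReal.toReal_mul, ENNReal.toReal_ofReal hA, measureReal_def]
  rw [havg, abs_mul, abs_of_pos (inv_pos.2 hreal), inv_mul_le_iff₀ hreal]
  linarith

theorem wnorm_sub_ravg_le [BorelSpace X] {μ : Measure X} {B : MBall X} (hpos : 0 < μ B.set)
    (hfin : μ B.set < ⊤) {f : X → ℝ} (hf : Measurable f) {c₀ p C K : ℝ} (hp : 1 < p)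
    (hC : 0 < C) (hK : 0 < K)
    (h : ∀ t : ℝ, 0 < t →
      μ {x ∈ B.set | t < |f x - c₀|} ≤ ENNReal.ofReal (C * (K / t) ^ p) * μ B.set) :
    wnorm μ B p (fun x => ENNReal.ofReal |f x - ravg μ B f|) ≤
      ENNReal.ofReal (2 * (1 + C / (p - 1)) + 2 * C ^ (1 / p)) * ENNReal.ofReal K := by
  have hp0 : 0 < p := by linarith
  have hp1 : 0 < p - 1 := by linarith
  set A := 1 + C / (p - 1) with hA
  have hA0 : 0 < A := by positivity
  have hgm : Measurable fun x => |f x - c₀| := by fun_prop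
  have havg : |ravg μ B f - c₀| ≤ A * K := by
    refine abs_ravg_sub_le hpos hfin hf (by positivity) ?_
    have := lintegral_le_of_measure_lt_le (ν := μ.restrict B.set) hgm (fun x => abs_nonneg _)
      hp hC.le hK (fun t ht => by
        rw [Measure.restrict_apply (measurableSet_lt measurable_const hgm),
          Measure.restrict_apply_univ, Set.inter_comm]
        exact h t ht)
    rwa [Measure.restrict_apply_univ] at this
  refine iSup₂_le fun t ht => ?_
  rw [← ENNReal.ofReal_mul (by positivity)]
  rcases le_or_gt t (2 * (A * K)) with hsmall | hbig
  · have h1 : (μ {x ∈ B.set | ENNReal.ofReal t < ENNReal.ofReal |f x - ravg μ B f|} / μ B.set) ^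
        (1 / p) ≤ 1 := by
      refine ENNReal.rpow_le_one ?_ (by positivity)
      exact ENNReal.div_le_of_le_mul (by
        rw [one_mul]; exact measure_mono (Set.sep_subset _ _))
    refine (mul_le_of_le_one_right' h1).trans (ENNReal.ofReal_le_ofReal ?_)
    have : 0 ≤ 2 * C ^ (1 / p) * K := by positivity
    linarith
  · have hsub : {x ∈ B.set | ENNReal.ofReal t < ENNReal.ofReal |f x - ravg μ B f|} ⊆
        {x ∈ B.set | t / 2 < |f x - c₀|} := by
      rintro x ⟨hx, hxt⟩
      have h1 := (ENNReal.ofReal_lt_ofReal_iff_of_nonneg ht.le).1 hxt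
      have h2 := abs_sub_le (f x) c₀ (ravg μ B f)
      rw [abs_sub_comm c₀] at h2
      exact ⟨hx, by linarith⟩
    have h1 : μ {x ∈ B.set | ENNReal.ofReal t < ENNReal.ofReal |f x - ravg μ B f|} / μ B.set ≤
        ENNReal.ofReal (C * (K / (t / 2)) ^ p) :=
      (ENNReal.div_le_iff hpos.ne' hfin.ne).2 ((measure_mono hsub).trans (h _ (by positivity)))
    have h2 : ENNReal.ofReal (C * (K / (t / 2)) ^ p) ^ (1 / p) =
        ENNReal.ofReal (C ^ (1 / p) * (K / (t / 2))) := by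
      rw [ENNReal.ofReal_rpow_of_nonneg (by positivity) (by positivity),
        Real.mul_rpow hC.le (by positivity), ← Real.rpow_mul (by positivity),
        mul_one_div_cancel hp0.ne', Real.rpow_one]
    calc ENNReal.ofReal t *
          (μ {x ∈ B.set | ENNReal.ofReal t < ENNReal.ofReal |f x - ravg μ B f|} / μ B.set) ^
            (1 / p)
        ≤ ENNReal.ofReal t * ENNReal.ofReal (C ^ (1 / p) * (K / (t / 2))) := by
          rw [← h2]
          gcongr
      _ = ENNReal.ofReal (2 * C ^ (1 / p) * K) := by
          rw [← ENNReal.ofReal_mul ht.le]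
          congr 1
          field_simp
      _ ≤ _ := by
          refine ENNReal.ofReal_le_ofReal ?_
          have : 0 ≤ 2 * A * K := by positivity
          linarith

end MBall

/-- **Embedding of the John–Nirenberg spaces `JN^ρ_{p,τ}` into weak `L^p`
(spaces of homogeneous type).** -/
theorem jn_embedding_metric
    {X : Type*} [MetricSpace X] [MeasurableSpace X] [BorelSpace X]
    (μ : Measure X) [μ.Regular] (cμ D : ℝ) (hcμ : 0 < cμ) (hD : 0 < D)
    (hdoubling : ∀ B B' : MBall X, B.set ⊆ B'.set → B.radius ≤ B'.radius →
      μ B'.set ≤ ENNReal.ofReal (cμ * (B'.radius / B.radius) ^ D) * μ B.set)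
    (hpos : ∀ B : MBall X, 0 < μ B.set) (hfin : ∀ B : MBall X, μ B.set < ⊤)
    (η : ℝ) (hη : 0 < η) (p ρ τ : ℝ) (hp : 1 < p) (hρ0 : 0 < ρ) (hρ1 : ρ ≤ 1)
    (hτ : 1 ≤ τ) :
    ∃ C : ℝ, 0 < C ∧
      ∀ (B : MBall X) (f : X → ℝ), Measurable f →
        (∫⁻ x in ((B.hat η hη).dilate τ (zero_lt_one.trans_le hτ)).set,
            ENNReal.ofReal (|f x| ^ ρ) ∂μ) < ⊤ →
        MBall.wnorm μ B p (fun x => ENNReal.ofReal |f x - MBall.ravg μ B f|)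
          ≤ ENNReal.ofReal C *
            MBall.jnNorm μ p ρ τ (zero_lt_one.trans_le hτ)
              ((B.hat η hη).dilate τ (zero_lt_one.trans_le hτ)) f := by
  obtain ⟨C, hC, hmain⟩ := MBall.exists_measure_lt_abs_sub_le μ hcμ hdoubling hD hpos hfin hη
    (one_pos.trans hp) hρ0 hρ1 hτ
  have hp1 : 0 < p - 1 := by linarith
  have hC' : 0 < 2 * (1 + C / (p - 1)) + 2 * C ^ (1 / p) := by positivity
  refine ⟨_, hC', fun B f hf _ => ?_⟩
  refine (ENNReal.div_le_iff_le_mul (Or.inl (ENNReal.ofReal_pos.2 hC').ne')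
    (Or.inl ENNReal.ofReal_ne_top)).1 ?_ |>.trans_eq (mul_comm _ _)
  refine le_of_forall_gt_imp_ge_of_dense fun k hk => ?_
  rcases eq_or_ne k ⊤ with rfl | hk'
  · exact le_top
  have hK : 0 < k.toReal := ENNReal.toReal_pos (pos_of_gt hk).ne' hk'
  rw [← ENNReal.ofReal_toReal hk'] at hk ⊢
  obtain ⟨c₀, hc₀⟩ := hmain B f hf k.toReal hK hk.le
  refine ENNReal.div_le_of_le_mul ?_
  rw [mul_comm]
  exact MBall.wnorm_sub_ravg_le (hpos B) (hfin B) hf hp hC hK hc₀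
end
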